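/- arXiv:2010.07282 — 8 statements merged into one kernel-verified Lean document; each statement's English description precedes it below -/
import Mathlib

section
/- Let N ≥ 1 and N∂ ≥ 1, let L be a real N×N matrix and B a real N×N∂ matrix, and let T be the (N+N∂)×(N+N∂) block matrix T = [[L, B],[0, I]], where I is the N∂×N∂ identity. Assume T is invertible with T⁻¹ ≥ 0 entrywise and every row sum of T is nonnegative. Then the discrete maximum principle holds: for every u ∈ ℝᴺ and u∂ ∈ ℝ^{N∂}, if (Lu + Bu∂)_i ≤ 0 for every i ∈ {1,…,N}, then max_{1≤i≤N} u_i ≤ max{0, max_{1≤j≤N∂} u∂_j}. -/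
/-- The block matrix `T = [[L, B], [0, I]]` of a finite difference scheme. -/
def blockT {N Nb : ℕ} (L : Matrix (Fin N) (Fin N) ℝ) (B : Matrix (Fin N) (Fin Nb) ℝ) :
    Matrix (Fin N ⊕ Fin Nb) (Fin N ⊕ Fin Nb) ℝ :=
  Matrix.fromBlocks L B (0 : Matrix (Fin Nb) (Fin N) ℝ) (1 : Matrix (Fin Nb) (Fin Nb) ℝ)

/-- A matrix with an entrywise nonnegative inverse is monotone: `0 ≤ A w` implies `0 ≤ w`. -/
theorem nonneg_of_mulVec_nonneg_of_inv_nonneg {n : Type*} [Fintype n] [DecidableEq n]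
    {A : Matrix n n ℝ} (hA : IsUnit A) (hinv : ∀ i j, 0 ≤ A⁻¹ i j) {w : n → ℝ}
    (hw : ∀ i, 0 ≤ A.mulVec w i) (i : n) : 0 ≤ w i := by
  have h : A⁻¹.mulVec (A.mulVec w) = w := by
    rw [Matrix.mulVec_mulVec, Matrix.nonsing_inv_mul A ((Matrix.isUnit_iff_isUnit_det A).mp hA),
      Matrix.one_mulVec]
  rw [← h]
  exact Finset.sum_nonneg fun j _ => mul_nonneg (hinv i j) (hw j)

/-- discrete maximum principle for a finite difference scheme whose
block matrix `T = [[L, B], [0, I]]` is inverse positive with nonnegative row sums. -/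
theorem stmt3 {N Nb : ℕ} (hN : 1 ≤ N) (hNb : 1 ≤ Nb)
    (L : Matrix (Fin N) (Fin N) ℝ) (B : Matrix (Fin N) (Fin Nb) ℝ)
    (hT : IsUnit (blockT L B))
    (hTinv : ∀ i j, 0 ≤ (blockT L B)⁻¹ i j)
    (hrow : ∀ i, 0 ≤ ∑ j, blockT L B i j)
    (u : Fin N → ℝ) (ub : Fin Nb → ℝ)
    (hscheme : ∀ i, (L.mulVec u + B.mulVec ub) i ≤ 0) :
    ∀ i, u i ≤ max 0 (⨆ j, ub j) := by
  intro i
  set M := max 0 (⨆ j, ub j) with hM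
  have hM0 : 0 ≤ M := le_max_left _ _
  have hMub : ∀ j, ub j ≤ M := fun j =>
    (le_ciSup (Set.finite_range ub).bddAbove j).trans (le_max_right _ _)
  have hmul : ∀ k, 0 ≤ (blockT L B).mulVec ((fun _ => M) - Sum.elim u ub) k := by
    intro k
    have hconst : (blockT L B).mulVec (fun _ => M) k = (∑ j, blockT L B k j) * M := by
      simp only [Matrix.mulVec, dotProduct, Finset.sum_mul]
    rw [Matrix.mulVec_sub, Pi.sub_apply, hconst]
    rcases k with k | k
    · have h1 : (blockT L B).mulVec (Sum.elim u ub) (Sum.inl k) ≤ 0 := by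
        simpa [blockT, Matrix.fromBlocks_mulVec] using hscheme k
      exact sub_nonneg.mpr (h1.trans (mul_nonneg (hrow _) hM0))
    · have h1 : (blockT L B).mulVec (Sum.elim u ub) (Sum.inr k) = ub k := by
        simp [blockT, Matrix.fromBlocks_mulVec]
      have h2 : ∑ j, blockT L B (Sum.inr k) j = 1 := by
        simp [blockT, Matrix.one_apply]
      rw [h1, h2, one_mul]
      exact sub_nonneg.mpr (hMub k)
  have h := nonneg_of_mulVec_nonneg_of_inv_nonneg hT hTinv hmul (Sum.inl i)
  exact sub_nonneg.mp h
end

section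
/- Let N ≥ 1 and N∂ ≥ 1, let L be a real N×N matrix and B a real N×N∂ matrix, and let T be the (N+N∂)×(N+N∂) block matrix T = [[L, B],[0, I]], where I is the N∂×N∂ identity. If T is invertible with T⁻¹ ≥ 0 entrywise, then L is invertible and L⁻¹ ≥ 0 entrywise. If moreover every row sum of T is nonnegative, then for every u ∈ ℝᴺ and u∂ ∈ ℝ^{N∂} with (Lu + Bu∂)_i ≤ 0 for every i ∈ {1,…,N}, one has max_{1≤i≤N} u_i ≤ max{0, max_{1≤j≤N∂} u∂_j}. -/
/-- An inverse-positive matrix satisfies: `A w ≤ 0` implies `w ≤ 0`. -/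
theorem Matrix.nonpos_of_mulVec_nonpos_of_inv_nonneg {n : Type*} [Fintype n] [DecidableEq n]
    {A : Matrix n n ℝ} (hA : IsUnit A) (hinv : ∀ i j, 0 ≤ A⁻¹ i j) {w : n → ℝ}
    (hw : ∀ i, A.mulVec w i ≤ 0) (i : n) : w i ≤ 0 := by
  have h : A⁻¹.mulVec (A.mulVec w) = w := by
    rw [Matrix.mulVec_mulVec, Matrix.nonsing_inv_mul _ ((Matrix.isUnit_iff_isUnit_det A).1 hA),
      Matrix.one_mulVec]
  rw [← h]
  exact Finset.sum_nonpos fun j _ => mul_nonpos_of_nonneg_of_nonpos (hinv i j) (hw j)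

/-- if the block matrix `T = [[L, B], [0, I]]` is inverse positive then so
is `L`; if moreover all row sums of `T` are nonnegative then the discrete maximum
principle holds. -/
theorem stmt4 {N Nb : ℕ} (hN : 1 ≤ N) (hNb : 1 ≤ Nb)
    (L : Matrix (Fin N) (Fin N) ℝ) (B : Matrix (Fin N) (Fin Nb) ℝ)
    (hT : IsUnit (blockT L B))
    (hTinv : ∀ i j, 0 ≤ (blockT L B)⁻¹ i j) :
    (IsUnit L ∧ ∀ i j, 0 ≤ L⁻¹ i j) ∧
      ((∀ i, 0 ≤ ∑ j, blockT L B i j) →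
        ∀ (u : Fin N → ℝ) (ub : Fin Nb → ℝ),
          (∀ i, (L.mulVec u + B.mulVec ub) i ≤ 0) →
          ∀ i, u i ≤ max 0 (⨆ j, ub j)) := by
  have hL : IsUnit L := (Matrix.isUnit_fromBlocks_zero₂₁.1 hT).1
  refine ⟨⟨hL, fun i j => ?_⟩, fun hrow u ub hu i => ?_⟩
  · have h := hTinv (Sum.inl i) (Sum.inl j)
    rwa [blockT, Matrix.inv_fromBlocks_zero₂₁_of_isUnit_iff _ _ _ (by simp [hL]),
      Matrix.fromBlocks_apply₁₁] at h
  · set M := max 0 (⨆ j, ub j) with hM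
    have hM0 : 0 ≤ M := le_max_left _ _
    have hub : ∀ j, ub j ≤ M := fun j =>
      (le_ciSup (Set.finite_range ub).bddAbove j).trans (le_max_right _ _)
    have key := Matrix.nonpos_of_mulVec_nonpos_of_inv_nonneg hT hTinv
      (w := Sum.elim u ub - fun _ => M) ?_ (Sum.inl i)
    · simpa using key
    · have hconst : ∀ k, (blockT L B).mulVec (fun _ => M) k = (∑ j, blockT L B k j) * M :=
        fun k => by simp only [Matrix.mulVec, dotProduct, Finset.sum_mul]
      rintro (k | k)
      · have hk := mul_nonneg (hrow (Sum.inl k)) hM0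
        have huk := hu k
        rw [Matrix.mulVec_sub, Pi.sub_apply, hconst]
        simp only [blockT, Matrix.fromBlocks_mulVec, Sum.elim_inl, Sum.elim_comp_inl,
          Sum.elim_comp_inr] at hk ⊢
        linarith
      · simpa [blockT, Matrix.fromBlocks_mulVec] using hub k
end

section
/- Let k ≥ 1 and let A, M₁, …, M_k, L be real n×n matrices. Assume: (i) A ≤ M₁M₂⋯M_k·L entrywise; (ii) each M_i is a nonsingular M-matrix; (iii) all off-diagonal entries of L are nonpositive; (iv) there exists a nonzero vector e ≥ 0 with Ae ≥ 0 such that at least one of the matrices M₁, …, M_k, L connects N⁰(Ae) with N⁺(Ae). Then M_k⁻¹M_{k-1}⁻¹⋯M₁⁻¹A is a nonsingular M-matrix; consequently A is a product of k+1 nonsingular M-matrices, A is invertible, and A⁻¹ ≥ 0 entrywise. -/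
/-- A nonsingular M-matrix: a Z-matrix (nonpositive off-diagonal entries) that is
invertible with entrywise nonnegative inverse. -/
def IsNonsingularMMatrix {n : ℕ} (A : Matrix (Fin n) (Fin n) ℝ) : Prop :=
  (∀ i j, i ≠ j → A i j ≤ 0) ∧ IsUnit A ∧ ∀ i j, 0 ≤ A⁻¹ i j

/-- `B` connects `N1` with `N2`: from every index in `N1` there is a directed path,
along nonzero entries of `B`, ending at some index of `N2`. -/
def Connects {n : ℕ} (B : Matrix (Fin n) (Fin n) ℝ) (N1 N2 : Set (Fin n)) : Prop :=
  ∀ i0 ∈ N1, ∃ r : ℕ, 1 ≤ r ∧ ∃ p : Fin (r + 1) → Fin n,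
    p 0 = i0 ∧ p (Fin.last r) ∈ N2 ∧ ∀ k : Fin r, B (p k.castSucc) (p k.succ) ≠ 0

/-- The set of indices where the vector `v` vanishes. -/
def Nzero {n : ℕ} (v : Fin n → ℝ) : Set (Fin n) := {i | v i = 0}

/-- The set of indices where the vector `v` is positive. -/
def Nplus {n : ℕ} (v : Fin n → ℝ) : Set (Fin n) := {i | 0 < v i}

open Matrix

/-- A zero of `y` forces a zero of `B y` and zeros of `y` at all neighbours. -/
theorem zero_propagates {n : ℕ} {B : Matrix (Fin n) (Fin n) ℝ}
    (hB : ∀ i j, i ≠ j → B i j ≤ 0) {y : Fin n → ℝ} (hy : 0 ≤ y) (hBy : 0 ≤ B *ᵥ y)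
    {i : Fin n} (hi : y i = 0) :
    (B *ᵥ y) i = 0 ∧ ∀ j, B i j ≠ 0 → y j = 0 := by
  have hterm : ∀ j ∈ Finset.univ, B i j * y j ≤ 0 := by
    intro j _
    rcases eq_or_ne i j with rfl | hij
    · simp [hi]
    · exact mul_nonpos_of_nonpos_of_nonneg (hB i j hij) (hy j)
  have hsum : (B *ᵥ y) i = ∑ j, B i j * y j := rfl
  have hzero : ∑ j, B i j * y j = 0 :=
    le_antisymm (Finset.sum_nonpos hterm) (hsum ▸ hBy i)
  refine ⟨hsum.trans hzero, fun j hj => ?_⟩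
  have := (Finset.sum_eq_zero_iff_of_nonpos hterm).1 hzero j (Finset.mem_univ j)
  exact (mul_eq_zero.1 this).resolve_left hj

theorem pos_of_connects {n : ℕ} {B C : Matrix (Fin n) (Fin n) ℝ}
    (hB : ∀ i j, i ≠ j → B i j ≤ 0) (hCB : ∀ i j, i ≠ j → C i j ≠ 0 → B i j ≠ 0)
    {y w : Fin n → ℝ} (hy : 0 ≤ y) (hBy : 0 ≤ B *ᵥ y) (hw : 0 ≤ w)
    (hwB : ∀ i, 0 < w i → 0 < (B *ᵥ y) i) (hC : Connects C (Nzero w) (Nplus w))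
    (i : Fin n) : 0 < y i := by
  refine (hy i).lt_of_ne' fun hi => ?_
  have hwi : w i = 0 := by
    by_contra h
    exact (hwB i ((hw i).lt_of_ne' h)).ne' (zero_propagates hB hy hBy hi).1
  obtain ⟨r, -, p, hp0, hpl, hp⟩ := hC i hwi
  have hall : ∀ k, y (p k) = 0 := by
    intro k
    induction k using Fin.induction with
    | zero => rwa [hp0]
    | succ k ih =>
      rcases eq_or_ne (p k.castSucc) (p k.succ) with h | h
      · rwa [← h]
      · exact (zero_propagates hB hy hBy ih).2 _ (hCB _ _ h (hp k))
  exact (hwB _ hpl).ne' (zero_propagates hB hy hBy (hall _)).1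

theorem isNonsingularMMatrix_of_monotone {n : ℕ} {B : Matrix (Fin n) (Fin n) ℝ}
    (hB : ∀ i j, i ≠ j → B i j ≤ 0) (hmono : ∀ x, 0 ≤ B *ᵥ x → 0 ≤ x) :
    IsNonsingularMMatrix B := by
  have hunit : IsUnit B := by
    rw [← Matrix.mulVec_injective_iff_isUnit]
    intro x z hxz
    have hxz : B *ᵥ x = B *ᵥ z := hxz
    refine le_antisymm ?_ ?_ <;>
    · rw [← sub_nonneg]
      apply hmono
      rw [Matrix.mulVec_sub, hxz, sub_self]
  refine ⟨hB, hunit, fun i j => ?_⟩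
  have hcol : 0 ≤ B⁻¹ *ᵥ Pi.single j 1 := by
    apply hmono
    rw [Matrix.mulVec_mulVec, Matrix.mul_nonsing_inv _ ((Matrix.isUnit_iff_isUnit_det B).1 hunit),
      Matrix.one_mulVec]
    exact Pi.single_nonneg.2 zero_le_one
  simpa using hcol i

theorem isNonsingularMMatrix_of_connects {n : ℕ} {B C : Matrix (Fin n) (Fin n) ℝ}
    (hB : ∀ i j, i ≠ j → B i j ≤ 0) (hCB : ∀ i j, i ≠ j → C i j ≠ 0 → B i j ≠ 0)
    {e w : Fin n → ℝ} (he : 0 ≤ e) (hBe : 0 ≤ B *ᵥ e) (hw : 0 ≤ w)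
    (hwB : ∀ i, 0 < w i → 0 < (B *ᵥ e) i) (hC : Connects C (Nzero w) (Nplus w)) :
    IsNonsingularMMatrix B := by
  have hpos := pos_of_connects hB hCB he hBe hw hwB hC
  refine isNonsingularMMatrix_of_monotone hB fun x hx => ?_
  by_contra hneg
  obtain ⟨j, hj⟩ : ∃ j, x j < 0 := by simpa [Pi.le_def] using hneg
  obtain ⟨i, -, hi⟩ := Finset.exists_min_image Finset.univ (fun i => x i / e i)
    ⟨j, Finset.mem_univ j⟩
  set t := x i / e i with ht
  have htneg : t < 0 := (hi j (Finset.mem_univ j)).trans_lt (div_neg_of_neg_of_pos hj (hpos j))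
  have hy : 0 ≤ x - t • e := by
    intro a
    have := (le_div_iff₀ (hpos a)).1 (hi a (Finset.mem_univ a))
    simpa using this
  have hmul : ∀ a, (B *ᵥ (x - t • e)) a = (B *ᵥ x) a + -t * (B *ᵥ e) a := by
    intro a
    rw [Matrix.mulVec_sub, Matrix.mulVec_smul]
    simp [sub_eq_add_neg]
  have hBy : 0 ≤ B *ᵥ (x - t • e) := fun a => by
    rw [hmul]
    exact add_nonneg (hx a) (mul_nonneg (neg_pos.2 htneg).le (hBe a))
  have hyi := pos_of_connects hB hCB hy hBy hw (fun a ha => by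
    rw [hmul]
    exact add_pos_of_nonneg_of_pos (hx a) (mul_pos (neg_pos.2 htneg) (hwB a ha))) hC i
  have : (x - t • e) i = 0 := by
    simp [ht, div_mul_cancel₀ _ (hpos i).ne']
  exact hyi.ne' this

namespace IsNonsingularMMatrix

variable {n : ℕ} {M : Matrix (Fin n) (Fin n) ℝ} {v : Fin n → ℝ}

theorem mulVec_inv_mulVec (hM : IsNonsingularMMatrix M) (v : Fin n → ℝ) :
    M *ᵥ (M⁻¹ *ᵥ v) = v := by
  rw [Matrix.mulVec_mulVec, Matrix.mul_nonsing_inv _ ((Matrix.isUnit_iff_isUnit_det M).1 hM.2.1),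
    Matrix.one_mulVec]

theorem inv_mulVec_nonneg (hM : IsNonsingularMMatrix M) (hv : 0 ≤ v) : 0 ≤ M⁻¹ *ᵥ v := by
  intro i
  change 0 ≤ ∑ j, M⁻¹ i j * v j
  exact Finset.sum_nonneg fun j _ => mul_nonneg (hM.2.2 i j) (hv j)

theorem inv_mulVec_pos (hM : IsNonsingularMMatrix M) (hv : 0 ≤ v) {i : Fin n} (hi : 0 < v i) :
    0 < (M⁻¹ *ᵥ v) i := by
  refine (hM.inv_mulVec_nonneg hv i).lt_of_ne' fun h => ?_
  have := (zero_propagates hM.1 (hM.inv_mulVec_nonneg hv)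
    (by rwa [hM.mulVec_inv_mulVec]) h).1
  rw [hM.mulVec_inv_mulVec] at this
  exact hi.ne' this

theorem isUnit_list_prod {l : List (Matrix (Fin n) (Fin n) ℝ)}
    (hl : ∀ M ∈ l, IsNonsingularMMatrix M) : IsUnit l.prod := by
  induction l with
  | nil => simp
  | cons M l ih =>
    rw [List.forall_mem_cons] at hl
    rw [List.prod_cons]
    exact hl.1.2.1.mul (ih hl.2)

theorem list_prod_inv_mulVec {l : List (Matrix (Fin n) (Fin n) ℝ)}
    (hl : ∀ M ∈ l, IsNonsingularMMatrix M) (hv : 0 ≤ v) :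
    0 ≤ l.prod⁻¹ *ᵥ v ∧ ∀ i, 0 < v i → 0 < (l.prod⁻¹ *ᵥ v) i := by
  induction l generalizing v with
  | nil => simpa using hv
  | cons M l ih =>
    rw [List.forall_mem_cons] at hl
    rw [List.prod_cons, Matrix.mul_inv_rev, ← Matrix.mulVec_mulVec]
    have h := ih hl.2 (hl.1.inv_mulVec_nonneg hv)
    exact ⟨h.1, fun i hi => h.2 i (hl.1.inv_mulVec_pos hv hi)⟩

theorem list_prod_inv_mulVec_pos_of_connects {l : List (Matrix (Fin n) (Fin n) ℝ)}
    (hl : ∀ M ∈ l, IsNonsingularMMatrix M) {w : Fin n → ℝ} (hw : 0 ≤ w) (hv : 0 ≤ v)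
    (hwv : ∀ i, 0 < w i → 0 < v i) (hM : M ∈ l) (hC : Connects M (Nzero w) (Nplus w))
    (i : Fin n) : 0 < (l.prod⁻¹ *ᵥ v) i := by
  induction l generalizing v with
  | nil => simp at hM
  | cons N l ih =>
    rw [List.forall_mem_cons] at hl
    rw [List.prod_cons, Matrix.mul_inv_rev, ← Matrix.mulVec_mulVec]
    have hN := hl.1.inv_mulVec_nonneg hv
    rcases List.mem_cons.1 hM with rfl | hM
    · refine (list_prod_inv_mulVec hl.2 hN).2 i ?_
      exact pos_of_connects hl.1.1 (fun _ _ _ h => h) hN (by rwa [hl.1.mulVec_inv_mulVec]) hw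
        (by rwa [hl.1.mulVec_inv_mulVec]) hC i
    · exact ih hl.2 hN (fun a ha => hl.1.inv_mulVec_pos hv (hwv a ha)) hM

end IsNonsingularMMatrix

/-- Lorenz: if `A ≤ M₁⋯M_k L` with each `Mᵢ` a nonsingular M-matrix, `L`
having nonpositive off-diagonal entries, and some `Mᵢ` or `L` connecting `N⁰(Ae)` with
`N⁺(Ae)` for some nonzero `e ≥ 0` with `Ae ≥ 0`, then `M_k⁻¹⋯M₁⁻¹A` is a nonsingular
M-matrix; hence `A` is a product of `k+1` nonsingular M-matrices and `A⁻¹ ≥ 0`. -/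
theorem stmt5 {n : ℕ} (k : ℕ) (hk : 1 ≤ k)
    (A : Matrix (Fin n) (Fin n) ℝ) (M : Fin k → Matrix (Fin n) (Fin n) ℝ)
    (L : Matrix (Fin n) (Fin n) ℝ)
    (hle : ∀ i j, A i j ≤ ((List.ofFn M).prod * L) i j)
    (hM : ∀ i, IsNonsingularMMatrix (M i))
    (hL : ∀ i j, i ≠ j → L i j ≤ 0)
    (hconn : ∃ e : Fin n → ℝ, e ≠ 0 ∧ (∀ i, 0 ≤ e i) ∧ (∀ i, 0 ≤ A.mulVec e i) ∧
      ((∃ i, Connects (M i) (Nzero (A.mulVec e)) (Nplus (A.mulVec e))) ∨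
        Connects L (Nzero (A.mulVec e)) (Nplus (A.mulVec e)))) :
    IsNonsingularMMatrix ((List.ofFn fun i => (M i)⁻¹).reverse.prod * A) ∧
      (∃ Ms : Fin (k + 1) → Matrix (Fin n) (Fin n) ℝ,
        (∀ i, IsNonsingularMMatrix (Ms i)) ∧ A = (List.ofFn Ms).prod) ∧
      IsUnit A ∧ ∀ i j, 0 ≤ A⁻¹ i j := by
  obtain ⟨e, -, he, hAe, hconn⟩ := hconn
  have hl : ∀ N ∈ List.ofFn M, IsNonsingularMMatrix N := List.forall_mem_ofFn_iff.2 hM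
  have hPeq : (List.ofFn fun i => (M i)⁻¹).reverse.prod = (List.ofFn M).prod⁻¹ := by
    rw [Matrix.list_prod_inv_reverse, List.map_reverse, List.map_ofFn]
    rfl
  rw [hPeq]
  have hQ := (Matrix.isUnit_iff_isUnit_det _).1 (IsNonsingularMMatrix.isUnit_list_prod hl)
  have hPnonneg := fun v hv => (IsNonsingularMMatrix.list_prod_inv_mulVec (v := v) hl hv).1
  have hPpos := (IsNonsingularMMatrix.list_prod_inv_mulVec hl hAe).2
  set Q := (List.ofFn M).prod with hQdef
  have hBL : ∀ i j, (Q⁻¹ * A) i j ≤ L i j := by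
    intro i j
    have h := hPnonneg (fun a => (Q * L - A) a j) (fun a => sub_nonneg.2 (hle a j)) i
    have h : 0 ≤ (Q⁻¹ * (Q * L - A)) i j := h
    rw [Matrix.mul_sub, Matrix.nonsing_inv_mul_cancel_left _ _ hQ] at h
    exact sub_nonneg.1 h
  have hBZ : ∀ i j, i ≠ j → (Q⁻¹ * A) i j ≤ 0 := fun i j hij => (hBL i j).trans (hL i j hij)
  have hBe : (Q⁻¹ * A) *ᵥ e = Q⁻¹ *ᵥ (A *ᵥ e) := (Matrix.mulVec_mulVec _ _ _).symm
  have hBe0 : 0 ≤ (Q⁻¹ * A) *ᵥ e := hBe ▸ hPnonneg _ hAe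
  have hB : IsNonsingularMMatrix (Q⁻¹ * A) := by
    rcases hconn with ⟨i, hi⟩ | hLc
    · have hpos : ∀ a, 0 < ((Q⁻¹ * A) *ᵥ e) a := by
        rw [hBe]
        exact IsNonsingularMMatrix.list_prod_inv_mulVec_pos_of_connects hl hAe hAe
          (fun _ h => h) (List.mem_ofFn.2 ⟨i, rfl⟩) hi
      exact isNonsingularMMatrix_of_connects (C := Q⁻¹ * A) hBZ (fun _ _ _ h => h) he hBe0 hBe0
        (fun _ h => h) fun a ha => absurd ha (hpos a).ne'
    · exact isNonsingularMMatrix_of_connects hBZ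
        (fun i j hij h => ((hBL i j).trans_lt ((hL i j hij).lt_of_ne h)).ne) he hBe0 hAe
        (hBe ▸ hPpos) hLc
  have hA : A = Q * (Q⁻¹ * A) := (Matrix.mul_nonsing_inv_cancel_left _ _ hQ).symm
  refine ⟨hB, ⟨Fin.snoc M (Q⁻¹ * A), fun i => ?_, ?_⟩, ?_, fun i j => ?_⟩
  · refine Fin.lastCases ?_ (fun a => ?_) i
    · simpa using hB
    · simpa using hM a
  · rw [List.ofFn_succ']
    simpa using hA
  · rw [hA]
    exact (IsNonsingularMMatrix.isUnit_list_prod hl).mul hB.2.1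
  · rw [hA, Matrix.mul_inv_rev]
    exact hB.inv_mulVec_nonneg (v := fun a => Q⁻¹ a j) (fun a => by
      simpa using hPnonneg (Pi.single j 1) (Pi.single_nonneg.2 zero_le_one) a) i
end

section
/- Let A be a real n×n matrix with positive diagonal entries, and write A = A_d + A_a⁺ + A_a⁻, where A_d is the diagonal part, A_a⁺ the positive off-diagonal part, and A_a⁻ the nonpositive off-diagonal part of A. Suppose A_a⁻ admits a decomposition A_a⁻ = A^z + A^s with A^z ≤ 0 and A^s ≤ 0 entrywise (both with zero diagonal), and suppose there exists a diagonal matrix A_{d*} with positive diagonal entries and A_{d*} ≥ A_d entrywise such that: (i) A_{d*} + A^z is a nonsingular M-matrix; (ii) A_a⁺ ≤ A^z·A_{d*}⁻¹·A^s entrywise; (iii) there exists a nonzero vector e ≥ 0 with Ae ≥ 0 such that A^z or A^s connects N⁰(Ae) with N⁺(Ae). Then A is a product of two nonsingular M-matrices; in particular A is invertible and A⁻¹ ≥ 0 entrywise. -/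
/-- The diagonal part `A_d` of a square matrix. -/
noncomputable def diagPart {n : ℕ} (A : Matrix (Fin n) (Fin n) ℝ) :
    Matrix (Fin n) (Fin n) ℝ :=
  Matrix.diagonal fun i => A i i

/-- The positive off-diagonal part `A_a⁺` of a square matrix. -/
noncomputable def offPos {n : ℕ} (A : Matrix (Fin n) (Fin n) ℝ) :
    Matrix (Fin n) (Fin n) ℝ :=
  fun i j => if i ≠ j ∧ 0 < A i j then A i j else 0

/-- The nonpositive off-diagonal part `A_a⁻` of a square matrix. -/
noncomputable def offNeg {n : ℕ} (A : Matrix (Fin n) (Fin n) ℝ) :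
    Matrix (Fin n) (Fin n) ℝ :=
  fun i j => if i ≠ j ∧ A i j < 0 then A i j else 0

/-- Every nonempty set of indices that is closed under the off-diagonal digraph of `B`
meets `Nplus v`. -/
def MeetsClosedSets {n : ℕ} (B : Matrix (Fin n) (Fin n) ℝ) (v : Fin n → ℝ) : Prop :=
  ∀ S : Set (Fin n), S.Nonempty → (∀ i ∈ S, ∀ j, i ≠ j → B i j ≠ 0 → j ∈ S) → ∃ i ∈ S, 0 < v i

theorem Connects.meetsClosedSets {n : ℕ} {B : Matrix (Fin n) (Fin n) ℝ} {v : Fin n → ℝ}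
    (h : Connects B (Nzero v) (Nplus v)) (hv : ∀ i, 0 ≤ v i) : MeetsClosedSets B v := by
  rintro S ⟨i, hi⟩ hS
  rcases (hv i).eq_or_lt with h0 | hpos
  · obtain ⟨r, -, p, hp0, hpr, hp⟩ := h i h0.symm
    have hmem : ∀ k : Fin (r + 1), p k ∈ S := by
      intro k
      induction k using Fin.induction with
      | zero => rwa [hp0]
      | succ k ih =>
        by_cases hk : p k.castSucc = p k.succ
        · rwa [← hk]
        · exact hS _ ih _ hk (hp k)
    exact ⟨_, hmem _, hpr⟩
  · exact ⟨i, hi, hpos⟩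

theorem mul_nonpos_of_apply_eq_zero {n : ℕ} {B : Matrix (Fin n) (Fin n) ℝ} {y : Fin n → ℝ}
    (hB : ∀ i j, i ≠ j → B i j ≤ 0) (hy : ∀ i, 0 ≤ y i) {i : Fin n} (hi : y i = 0) (j : Fin n) :
    B i j * y j ≤ 0 := by
  by_cases h : i = j
  · simp [← h, hi]
  · exact mul_nonpos_of_nonpos_of_nonneg (hB i j h) (hy j)

/-- A nonnegative vector with nonnegative image under a Z-matrix is positive as soon as
its image is positive somewhere on every closed set. -/
theorem MeetsClosedSets.pos {n : ℕ} {B : Matrix (Fin n) (Fin n) ℝ} {v y : Fin n → ℝ}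
    (h : MeetsClosedSets B v) (hB : ∀ i j, i ≠ j → B i j ≤ 0) (hy : ∀ i, 0 ≤ y i)
    (hBy : ∀ i, 0 ≤ B.mulVec y i) (hv : ∀ i, 0 < v i → 0 < B.mulVec y i) (i : Fin n) :
    0 < y i := by
  refine lt_of_le_of_ne (hy i) fun hi => ?_
  obtain ⟨k, hk, hvk⟩ := h {i | y i = 0} ⟨i, hi.symm⟩ fun k hk j hkj hBkj => by
    have hterm := mul_nonpos_of_apply_eq_zero hB hy hk
    have hsum : ∑ j, B k j * y j = 0 :=
      le_antisymm (Finset.sum_nonpos fun j _ => hterm j) (hBy k)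
    have := (Finset.sum_eq_zero_iff_of_nonpos fun j _ => hterm j).1 hsum j (Finset.mem_univ j)
    exact (mul_eq_zero.1 this).resolve_left hBkj
  refine (hv k hvk).not_ge ?_
  rw [Matrix.mulVec, dotProduct]
  exact Finset.sum_nonpos fun j _ => mul_nonpos_of_apply_eq_zero hB hy hk j

/-- A Z-matrix that sends a nonnegative vector to a nonnegative vector which is positive
somewhere on every closed set is a nonsingular M-matrix. -/
theorem isNonsingularMMatrix_of_meetsClosedSets {n : ℕ} {B : Matrix (Fin n) (Fin n) ℝ}
    {e : Fin n → ℝ} (hB : ∀ i j, i ≠ j → B i j ≤ 0) (he : ∀ i, 0 ≤ e i)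
    (hBe : ∀ i, 0 ≤ B.mulVec e i) (h : MeetsClosedSets B (B.mulVec e)) :
    IsNonsingularMMatrix B := by
  have hpos : ∀ i, 0 < e i := h.pos hB he hBe fun _ hi => hi
  have hmono : ∀ x : Fin n → ℝ, (∀ i, 0 ≤ B.mulVec x i) → ∀ i, 0 ≤ x i := by
    intro x hx i
    by_contra! hi
    have : Nonempty (Fin n) := ⟨i⟩
    obtain ⟨k, hk⟩ := Finite.exists_min fun j => x j / e j
    set t := x k / e k with ht
    have ht0 : t < 0 := (hk i).trans_lt (div_neg_of_neg_of_pos hi (hpos i))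
    have hmul : ∀ j, B.mulVec (x - t • e) j = B.mulVec x j - t * B.mulVec e j := fun j => by
      simp [Matrix.mulVec_sub, Matrix.mulVec_smul]
    have hy : 0 < (x - t • e) k := by
      refine h.pos (y := x - t • e) hB (fun j => ?_) (fun j => ?_) (fun j hj => ?_) k
      · have := (le_div_iff₀ (hpos j)).1 (hk j)
        simpa using this
      · rw [hmul]
        nlinarith [hx j, mul_nonneg (neg_nonneg.2 ht0.le) (hBe j)]
      · rw [hmul]
        nlinarith [hx j, mul_pos (neg_pos.2 ht0) hj]
    have hk0 : (x - t • e) k = 0 := by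
      simp [ht, (hpos k).ne']
    exact hy.ne' hk0
  have hunit : IsUnit B := by
    refine Matrix.mulVec_injective_iff_isUnit.1 fun x y hxy => ?_
    replace hxy : B.mulVec x = B.mulVec y := hxy
    funext i
    have h1 := hmono (x - y) (by simp [Matrix.mulVec_sub, hxy]) i
    have h2 := hmono (y - x) (by simp [Matrix.mulVec_sub, hxy]) i
    simp only [Pi.sub_apply] at h1 h2
    linarith
  refine ⟨hB, hunit, fun i j => ?_⟩
  refine hmono (B⁻¹.col j) (fun k => ?_) i
  have hcol : B.mulVec (B⁻¹.col j) k = (B * B⁻¹) k j := rfl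
  rw [hcol, Matrix.mul_nonsing_inv _ ((Matrix.isUnit_iff_isUnit_det B).1 hunit), Matrix.one_apply]
  split_ifs <;> norm_num

/-- The product of two nonsingular M-matrices is invertible with nonnegative inverse. -/
theorem IsNonsingularMMatrix.isUnit_mul_and_inv_nonneg {n : ℕ}
    {M N : Matrix (Fin n) (Fin n) ℝ} (hM : IsNonsingularMMatrix M)
    (hN : IsNonsingularMMatrix N) : IsUnit (M * N) ∧ ∀ i j, 0 ≤ (M * N)⁻¹ i j := by
  refine ⟨hM.2.1.mul hN.2.1, fun i j => ?_⟩
  rw [Matrix.mul_inv_rev, Matrix.mul_apply]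
  exact Finset.sum_nonneg fun k _ => mul_nonneg (hN.2.2 i k) (hM.2.2 k j)

theorem apply_eq_diagPart_add_offNeg_add_offPos {n : ℕ} (A : Matrix (Fin n) (Fin n) ℝ)
    (i j : Fin n) : A i j = diagPart A i j + offNeg A i j + offPos A i j := by
  by_cases hij : i = j
  · simp [diagPart, offNeg, offPos, hij]
  · rcases lt_trichotomy (A i j) 0 with h | h | h <;>
      simp [diagPart, offNeg, offPos, hij, h, h.not_gt]

/-- relaxed Lorenz's condition: if `A` has positive diagonal entries,
`A_a⁻ = A^z + A^s` with `A^z, A^s ≤ 0` (zero diagonals), and there is a diagonal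
matrix `A_{d*} ≥ A_d` with positive diagonal entries such that `A_{d*} + A^z` is a
nonsingular M-matrix, `A_a⁺ ≤ A^z A_{d*}⁻¹ A^s`, and `A^z` or `A^s` connects `N⁰(Ae)`
with `N⁺(Ae)` for some nonzero `e ≥ 0` with `Ae ≥ 0`, then `A` is a product of two
nonsingular M-matrices; in particular `A⁻¹ ≥ 0`. -/
theorem stmt8 {n : ℕ} (A Az As : Matrix (Fin n) (Fin n) ℝ) (dstar : Fin n → ℝ)
    (hdiag : ∀ i, 0 < A i i)
    (hAz : ∀ i j, Az i j ≤ 0) (hAs : ∀ i j, As i j ≤ 0)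
    (hAzd : ∀ i, Az i i = 0) (hAsd : ∀ i, As i i = 0)
    (hdecomp : Az + As = offNeg A)
    (hdstarpos : ∀ i, 0 < dstar i)
    (hdstarge : ∀ i j, diagPart A i j ≤ Matrix.diagonal dstar i j)
    (hM : IsNonsingularMMatrix (Matrix.diagonal dstar + Az))
    (hprod : ∀ i j, offPos A i j ≤ (Az * (Matrix.diagonal dstar)⁻¹ * As) i j)
    (hconn : ∃ e : Fin n → ℝ, e ≠ 0 ∧ (∀ i, 0 ≤ e i) ∧ (∀ i, 0 ≤ A.mulVec e i) ∧
      (Connects Az (Nzero (A.mulVec e)) (Nplus (A.mulVec e)) ∨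
        Connects As (Nzero (A.mulVec e)) (Nplus (A.mulVec e)))) :
    (∃ M1 M2 : Matrix (Fin n) (Fin n) ℝ,
        IsNonsingularMMatrix M1 ∧ IsNonsingularMMatrix M2 ∧ A = M1 * M2) ∧
      IsUnit A ∧ ∀ i j, 0 ≤ A⁻¹ i j := by
  obtain ⟨e, -, he, hAe, hc⟩ := hconn
  set M := Matrix.diagonal dstar + Az with hMdef
  have hMdet : IsUnit M.det := (Matrix.isUnit_iff_isUnit_det M).1 hM.2.1
  have hdd : Matrix.diagonal dstar * Matrix.diagonal (fun i => (dstar i)⁻¹) = 1 := by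
    rw [Matrix.diagonal_mul_diagonal, ← Matrix.diagonal_one]
    congr 1
    funext i
    exact mul_inv_cancel₀ (hdstarpos i).ne'
  have hDinv : (Matrix.diagonal dstar)⁻¹ = Matrix.diagonal fun i => (dstar i)⁻¹ :=
    Matrix.inv_eq_right_inv hdd
  have hDD : Matrix.diagonal dstar * (Matrix.diagonal dstar)⁻¹ = 1 := hDinv ▸ hdd
  have hMmul : M * (1 + (Matrix.diagonal dstar)⁻¹ * As) =
      Matrix.diagonal dstar + (Az + As) + Az * (Matrix.diagonal dstar)⁻¹ * As := by
    rw [hMdef, mul_add, mul_one, ← mul_assoc, add_mul, hDD, add_mul, one_mul]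
    abel
  have hAle : ∀ i j, A i j ≤ (M * (1 + (Matrix.diagonal dstar)⁻¹ * As)) i j := by
    intro i j
    rw [hMmul, hdecomp, Matrix.add_apply, Matrix.add_apply,
      apply_eq_diagPart_add_offNeg_add_offPos A i j]
    linarith [hdstarge i j, hprod i j]
  have hBle : ∀ i j, i ≠ j → (M⁻¹ * A) i j ≤ (dstar i)⁻¹ * As i j := by
    intro i j hij
    calc (M⁻¹ * A) i j ≤ (M⁻¹ * (M * (1 + (Matrix.diagonal dstar)⁻¹ * As))) i j := by
          rw [Matrix.mul_apply, Matrix.mul_apply]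
          exact Finset.sum_le_sum fun k _ => mul_le_mul_of_nonneg_left (hAle k j) (hM.2.2 i k)
      _ = (dstar i)⁻¹ * As i j := by
          rw [Matrix.nonsing_inv_mul_cancel_left _ _ hMdet, hDinv, Matrix.add_apply,
            Matrix.one_apply_ne hij, zero_add, Matrix.diagonal_mul]
  have hBZ : ∀ i j, i ≠ j → (M⁻¹ * A) i j ≤ 0 := fun i j hij =>
    (hBle i j hij).trans
      (mul_nonpos_of_nonneg_of_nonpos (inv_pos.2 (hdstarpos i)).le (hAs i j))
  have hA : A = M * (M⁻¹ * A) := (Matrix.mul_nonsing_inv_cancel_left _ _ hMdet).symm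
  have hMu : M.mulVec ((M⁻¹ * A).mulVec e) = A.mulVec e := by
    rw [Matrix.mulVec_mulVec, ← hA]
  have hu : ∀ i, 0 ≤ (M⁻¹ * A).mulVec e i := by
    intro i
    rw [← Matrix.mulVec_mulVec, Matrix.mulVec, dotProduct]
    exact Finset.sum_nonneg fun k _ => mul_nonneg (hM.2.2 i k) (hAe k)
  have hB : IsNonsingularMMatrix (M⁻¹ * A) := by
    refine isNonsingularMMatrix_of_meetsClosedSets hBZ he hu ?_
    rcases hc with hc | hc
    · have hmeet : MeetsClosedSets M (A.mulVec e) := fun S hS hcl =>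
        hc.meetsClosedSets hAe S hS fun i hi j hij hz =>
          hcl i hi j hij (by simpa [hMdef, Matrix.diagonal_apply_ne _ hij] using hz)
      have hpos := hmeet.pos hM.1 hu (by simpa only [hMu] using hAe) (fun i hi => by rwa [hMu])
      rintro S ⟨i, hi⟩ -
      exact ⟨i, hi, hpos i⟩
    · intro S hS hcl
      obtain ⟨i, hi, hvi⟩ := hc.meetsClosedSets hAe S hS fun i hi j hij hs =>
        hcl i hi j hij ((hBle i j hij).trans_lt
          (mul_neg_of_pos_of_neg (inv_pos.2 (hdstarpos i)) (lt_of_le_of_ne (hAs i j) hs))).ne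
      refine ⟨i, hi, lt_of_le_of_ne (hu i) fun h0 => hvi.not_ge ?_⟩
      rw [← hMu, Matrix.mulVec, dotProduct]
      exact Finset.sum_nonpos fun j _ => mul_nonpos_of_apply_eq_zero hM.1 hu h0.symm j
  refine ⟨⟨M, M⁻¹ * A, hM, hB, hA⟩, ?_⟩
  have hinv := hM.isUnit_mul_and_inv_nonneg hB
  rwa [← hA] at hinv
end

section
/- Assume that for all indices 1 ≤ p ≤ P−1 and 1 ≤ q ≤ P−1, with h_a = w_{p+1}, h_{a−1} = w_p, h_b = v_{q+1}, h_{b−1} = v_q, the following mesh constraints hold: h_a·h_{a−1} ≥ (7/12)·max{h_b², h_{b−1}²}, h_b·h_{b−1} ≥ (7/12)·max{h_a², h_{a−1}²}, min{h_a, h_{a−1}} ≥ (1/√3)·max{h_b, h_{b−1}}, and min{h_b, h_{b−1}} ≥ (1/√3)·max{h_a, h_{a−1}}. Then the Q² variational difference matrix L̄ is invertible and L̄⁻¹ ≥ 0 entrywise (the scheme is monotone). -/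
/-- The entry of the `Q²` variational difference matrix (for `-Δu = f` with Dirichlet
boundary conditions) at row `(i, j)` and column `(k, l)`, on a nonuniform rectangular
mesh whose half cell widths are `w 1, …, w P` and half cell heights `v 1, …, v P`,
with grid indices `0 ≤ i, j ≤ n+1`. -/
noncomputable def q2Entry (n : ℕ) (w v : ℕ → ℝ) (i j k l : ℕ) : ℝ :=
  if i = 0 ∨ i = n + 1 ∨ j = 0 ∨ j = n + 1 then
    -- boundary point
    if k = i ∧ l = j then 1 else 0
  else
    let ha : ℝ := if i % 2 = 1 then w ((i + 1) / 2) else w (i / 2 + 1)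
    let ha1 : ℝ := if i % 2 = 1 then w ((i + 1) / 2) else w (i / 2)
    let hb : ℝ := if j % 2 = 1 then v ((j + 1) / 2) else v (j / 2 + 1)
    let hb1 : ℝ := if j % 2 = 1 then v ((j + 1) / 2) else v (j / 2)
    if i % 2 = 1 then
      if j % 2 = 1 then
        -- cell center
        if k = i ∧ l = j then (2 * ha ^ 2 + 2 * hb ^ 2) / (ha ^ 2 * hb ^ 2)
        else if (k = i + 1 ∨ k + 1 = i) ∧ l = j then -(1 / ha ^ 2)
        else if k = i ∧ (l = j + 1 ∨ l + 1 = j) then -(1 / hb ^ 2)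
        else 0
      else
        -- edge center of an edge parallel to the x-axis
        if k = i ∧ l = j then (7 * ha ^ 2 + 4 * hb * hb1) / (2 * hb * hb1 * ha ^ 2)
        else if k = i ∧ l = j + 1 then -(4 / (hb * (hb + hb1)))
        else if k = i ∧ l + 1 = j then -(4 / (hb1 * (hb + hb1)))
        else if (k = i + 1 ∨ k + 1 = i) ∧ l = j then -(1 / ha ^ 2)
        else if k = i ∧ l = j + 2 then 1 / (2 * hb * (hb + hb1))
        else if k = i ∧ l + 2 = j then 1 / (2 * hb1 * (hb + hb1))
        else 0
    else
      if j % 2 = 1 then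
        -- edge center of an edge parallel to the y-axis
        if k = i ∧ l = j then (7 * hb ^ 2 + 4 * ha * ha1) / (2 * ha * ha1 * hb ^ 2)
        else if k = i + 1 ∧ l = j then -(4 / (ha * (ha + ha1)))
        else if k + 1 = i ∧ l = j then -(4 / (ha1 * (ha + ha1)))
        else if k = i ∧ (l = j + 1 ∨ l + 1 = j) then -(1 / hb ^ 2)
        else if k = i + 2 ∧ l = j then 1 / (2 * ha * (ha + ha1))
        else if k + 2 = i ∧ l = j then 1 / (2 * ha1 * (ha + ha1))
        else 0
      else
        -- knot
        if k = i ∧ l = j then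
          (7 * ha * ha1 + 7 * hb * hb1) / (2 * ha * ha1 * hb * hb1)
        else if k = i + 1 ∧ l = j then -(4 / (ha * (ha + ha1)))
        else if k + 1 = i ∧ l = j then -(4 / (ha1 * (ha + ha1)))
        else if k = i ∧ l = j + 1 then -(4 / (hb * (hb + hb1)))
        else if k = i ∧ l + 1 = j then -(4 / (hb1 * (hb + hb1)))
        else if k = i + 2 ∧ l = j then 1 / (2 * ha * (ha + ha1))
        else if k + 2 = i ∧ l = j then 1 / (2 * ha1 * (ha + ha1))
        else if k = i ∧ l = j + 2 then 1 / (2 * hb * (hb + hb1))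
        else if k = i ∧ l + 2 = j then 1 / (2 * hb1 * (hb + hb1))
        else 0

/-- The `Q²` variational difference matrix `L̄` on the grid `{0, …, n+1}²`. -/
noncomputable def q2Matrix (n : ℕ) (w v : ℕ → ℝ) :
    Matrix (Fin (n + 2) × Fin (n + 2)) (Fin (n + 2) × Fin (n + 2)) ℝ :=
  fun p q => q2Entry n w v p.1.val p.2.val q.1.val q.2.val


section Monotone

variable {ι : Type*} [Fintype ι]

open Matrix

/-- A matrix with nonpositive off-diagonal entries which maps some positive vector to a positive
vector is monotone. -/
theorem nonneg_of_mulVec_nonneg_of_offDiag_nonpos (B : Matrix ι ι ℝ) (e x : ι → ℝ)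
    (hB : ∀ p q, p ≠ q → B p q ≤ 0) (he : ∀ p, 0 < e p) (hBe : ∀ p, 0 < (B *ᵥ e) p)
    (hx : ∀ p, 0 ≤ (B *ᵥ x) p) (p : ι) : 0 ≤ x p := by
  by_contra! hp
  have : Nonempty ι := ⟨p⟩
  obtain ⟨r, hr⟩ := Finite.exists_min fun q => x q / e q
  set t := x r / e r with ht
  have htneg : t < 0 := (hr p).trans_lt (div_neg_of_neg_of_pos hp (he p))
  have hdiff : ∀ q, 0 ≤ x q - t * e q := fun q => by
    have := (le_div_iff₀ (he q)).1 (hr q)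
    linarith
  have hzero : x r - t * e r = 0 := by
    rw [ht, div_mul_cancel₀ _ (he r).ne', sub_self]
  have hle : ∑ q, B r q * (x q - t * e q) ≤ 0 := by
    refine Finset.sum_nonpos fun q _ => ?_
    by_cases h : r = q
    · rw [← h, hzero, mul_zero]
    · exact mul_nonpos_of_nonpos_of_nonneg (hB r q h) (hdiff q)
  have heq : ∑ q, B r q * (x q - t * e q) = (B *ᵥ x) r - t * (B *ᵥ e) r := by
    simp only [mulVec, dotProduct, Finset.mul_sum, ← Finset.sum_sub_distrib]
    exact Finset.sum_congr rfl fun q _ => by ring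
  nlinarith [hx r, hBe r]

variable [DecidableEq ι]

theorem isUnit_and_inv_nonneg_of_monotone (A : Matrix ι ι ℝ)
    (hA : ∀ x : ι → ℝ, (∀ p, 0 ≤ (A *ᵥ x) p) → ∀ p, 0 ≤ x p) :
    IsUnit A ∧ ∀ p q, 0 ≤ A⁻¹ p q := by
  have hunit : IsUnit A := by
    rw [← Matrix.mulVec_injective_iff_isUnit]
    have key : ∀ x y : ι → ℝ, A *ᵥ x = A *ᵥ y → ∀ p, x p ≤ y p := fun x y h p => by
      have := hA (y - x) (fun q => by rw [mulVec_sub, h, sub_self]; rfl) p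
      simpa using this
    exact fun x y h => funext fun p => le_antisymm (key x y h p) (key y x h.symm p)
  refine ⟨hunit, fun p q => ?_⟩
  have hmul : A * A⁻¹ = 1 := mul_nonsing_inv A ((isUnit_iff_isUnit_det A).1 hunit)
  refine hA (fun r => A⁻¹ r q) (fun r => ?_) p
  change 0 ≤ (A * A⁻¹) r q
  rw [hmul, one_apply]
  split_ifs <;> norm_num

/-- Suppose a matrix `A` with positive diagonal has a grading `lev` of its index set by `0, 1, 2`
such that entries between different levels are nonpositive, while every off-diagonal entry within
a level is either nonpositive or compensated by a product along a path through a higher level.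
If `A` maps some positive vector to a positive vector, then `A` is monotone: it is dominated by
a product of two M-matrices. -/
theorem isUnit_and_inv_nonneg_of_graded (A : Matrix ι ι ℝ) (lev : ι → ℕ) (e : ι → ℝ)
    (hlev : ∀ p, lev p ≤ 2) (hdiag : ∀ p, 0 < A p p)
    (hoff : ∀ p q, lev p ≠ lev q → A p q ≤ 0)
    (hpath : ∀ p q, p ≠ q → lev p = lev q →
      A p q ≤ 0 ∨ ∃ r, lev p < lev r ∧ A p q * A r r ≤ A p r * A r q)
    (he : ∀ p, 0 < e p) (hAe : ∀ p, 0 < (A *ᵥ e) p) :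
    IsUnit A ∧ ∀ p q, 0 ≤ A⁻¹ p q := by
  set N : Matrix ι ι ℝ := fun p r => if lev p < lev r then -A p r / A r r else 0 with hN
  set S : Matrix ι ι ℝ := fun p q => if p = q ∨ lev q < lev p then A p q else 0 with hS
  have hN0 : ∀ p r, 0 ≤ N p r := fun p r => by
    simp only [hN]
    split_ifs with h
    · exact div_nonneg (neg_nonneg.2 (hoff p r h.ne)) (hdiag r).le
    · exact le_rfl
  have hNlev : ∀ p r, N p r ≠ 0 → lev p < lev r := fun p r h => by
    by_contra h'
    exact h (if_neg h')
  have hN3 : N * N * N = 0 := by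
    ext p q
    simp only [mul_apply, Finset.sum_mul, Matrix.zero_apply]
    refine Finset.sum_eq_zero fun r _ => Finset.sum_eq_zero fun s _ => ?_
    by_contra h
    have h1 := hNlev p s fun h0 => h (by rw [h0, zero_mul, zero_mul])
    have h2 := hNlev s r fun h0 => h (by rw [h0, mul_zero, zero_mul])
    have h3 := hNlev r q fun h0 => h (by rw [h0, mul_zero])
    have := hlev q
    omega
  have hNS : ∀ p q r, N p r * S r q ≤ if r = q then N p r * A q q else 0 := by
    intro p q r
    split_ifs with h
    · simp [hS, h]
    · refine mul_nonpos_of_nonneg_of_nonpos (hN0 p r) ?_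
      simp only [hS]
      split_ifs with h'
      · exact hoff r q (by rcases h' with h' | h'; exacts [absurd h' h, h'.ne'])
      · exact le_rfl
  have hdom : ∀ p q, A p q ≤ ((1 - N) * S) p q := by
    intro p q
    rw [sub_mul, one_mul, Matrix.sub_apply, mul_apply]
    by_cases hpq : p = q
    · subst hpq
      have hterm : ∑ r, N p r * S r p ≤ 0 := Finset.sum_nonpos fun r _ => by
        refine (hNS p p r).trans ?_
        split_ifs with h
        · rw [h, show N p p = 0 from if_neg (lt_irrefl _), zero_mul]
        · exact le_rfl
      have hSp : S p p = A p p := if_pos (Or.inl rfl)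
      linarith
    · rcases lt_trichotomy (lev p) (lev q) with h | h | h
      · have hSp : S p q = 0 := if_neg (by rintro (h' | h'); exacts [hpq h', by omega])
        have hsum : ∑ r, N p r * S r q ≤ N p q * A q q := by
          refine (Finset.sum_le_sum fun r _ => hNS p q r).trans ?_
          simp
        have hNq : N p q * A q q = -A p q := by
          simp only [hN, if_pos h]
          exact div_mul_cancel₀ _ (hdiag q).ne'
        linarith
      · have hSp : S p q = 0 := if_neg (by rintro (h' | h'); exacts [hpq h', by omega])
        have hNq : N p q = 0 := if_neg (by omega)
        have hterm : ∀ r, N p r * S r q ≤ 0 := fun r => by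
          refine (hNS p q r).trans ?_
          split_ifs with h'
          · rw [h', hNq, zero_mul]
          · exact le_rfl
        rcases hpath p q hpq h with h0 | ⟨r, hr, hle⟩
        · have := Finset.sum_nonpos fun r (_ : r ∈ Finset.univ) => hterm r
          linarith
        · have h1 : ∑ r, -(N p r * S r q) ≥ -(N p r * S r q) :=
            Finset.single_le_sum (f := fun r => -(N p r * S r q))
              (fun s _ => neg_nonneg.2 (hterm s)) (Finset.mem_univ r)
          rw [Finset.sum_neg_distrib] at h1
          have h2 : A p q ≤ -(N p r * S r q) := by
            have hSr : S r q = A r q := if_pos (Or.inr (by omega))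
            have hNr : N p r = -A p r / A r r := if_pos hr
            rw [hSr, hNr]
            have : -(-A p r / A r r * A r q) = A p r * A r q / A r r := by ring
            rw [this, le_div_iff₀ (hdiag r)]
            exact hle
          linarith
      · have hSp : S p q = A p q := if_pos (Or.inr h)
        have hNq : N p q = 0 := if_neg (by omega)
        have : ∑ r, N p r * S r q ≤ 0 := Finset.sum_nonpos fun r _ => by
          refine (hNS p q r).trans ?_
          split_ifs with h'
          · rw [h', hNq, zero_mul]
          · exact le_rfl
        linarith
  set K : Matrix ι ι ℝ := 1 + N + N * N with hK
  have hNN : ∀ p q, 0 ≤ (N * N) p q := fun p q => by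
    rw [mul_apply]
    exact Finset.sum_nonneg fun r _ => mul_nonneg (hN0 p r) (hN0 r q)
  have hK1 : ∀ p q, (1 : Matrix ι ι ℝ) p q ≤ K p q := fun p q => by
    simp only [hK, Matrix.add_apply]
    linarith [hN0 p q, hNN p q]
  have hK0 : ∀ p q, 0 ≤ K p q := fun p q => by
    refine le_trans ?_ (hK1 p q)
    rw [one_apply]
    split_ifs <;> norm_num
  have hKN : K * (1 - N) = 1 := by
    have : K * (1 - N) = 1 - N * N * N := by rw [hK]; noncomm_ring
    rw [this, hN3, sub_zero]
  have hKA : ∀ p q, (K * A) p q ≤ S p q := fun p q => by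
    have : S = K * ((1 - N) * S) := by rw [← mul_assoc, hKN, one_mul]
    rw [this, mul_apply, mul_apply]
    exact Finset.sum_le_sum fun r _ => mul_le_mul_of_nonneg_left (hdom r q) (hK0 p r)
  have hKmul : ∀ y : ι → ℝ, (∀ p, 0 ≤ y p) → ∀ p, y p ≤ (K *ᵥ y) p := fun y hy p => by
    conv_lhs => rw [← one_mulVec y]
    exact Finset.sum_le_sum fun q _ => mul_le_mul_of_nonneg_right (hK1 p q) (hy q)
  refine isUnit_and_inv_nonneg_of_monotone A fun x hx =>
    nonneg_of_mulVec_nonneg_of_offDiag_nonpos (K * A) e x (fun p q hpq => ?_) he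
      (fun p => ?_) (fun p => ?_)
  · refine (hKA p q).trans ?_
    simp only [hS]
    split_ifs with h
    · exact hoff p q (by rcases h with h | h; exacts [absurd h hpq, h.ne'])
    · exact le_rfl
  · rw [← mulVec_mulVec]
    exact (hAe p).trans_le (hKmul _ (fun q => (hAe q).le) p)
  · rw [← mulVec_mulVec]
    exact (hx p).trans (hKmul _ hx p)

end Monotone

theorem q2Entry_center (m a b k l : ℕ) (w v : ℕ → ℝ)
    (ha : a ≤ m) (hb : b ≤ m) :
    q2Entry (2 * m + 1) w v (2 * a + 1) (2 * b + 1) k l =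
      if k = 2 * a + 1 ∧ l = 2 * b + 1 then
        (2 * w (a + 1) ^ 2 + 2 * v (b + 1) ^ 2) / (w (a + 1) ^ 2 * v (b + 1) ^ 2)
      else if k = 2 * a + 2 ∧ l = 2 * b + 1 then -(1 / w (a + 1) ^ 2)
      else if k = 2 * a ∧ l = 2 * b + 1 then -(1 / w (a + 1) ^ 2)
      else if k = 2 * a + 1 ∧ l = 2 * b + 2 then -(1 / v (b + 1) ^ 2)
      else if k = 2 * a + 1 ∧ l = 2 * b then -(1 / v (b + 1) ^ 2)
      else 0 := by
  unfold q2Entry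
  rw [if_neg (by omega)]
  simp only [show (2 * a + 1) % 2 = 1 by omega, show (2 * b + 1) % 2 = 1 by omega,
    show (2 * a + 1 + 1) / 2 = a + 1 by omega,
    show (2 * b + 1 + 1) / 2 = b + 1 by omega,
    if_true, add_assoc, Nat.reduceAdd]
  split_ifs <;> first | rfl | (exfalso; omega)

theorem q2Entry_verticalEdge (m a b k l : ℕ) (w v : ℕ → ℝ)
    (ha : a < m) (hb : b ≤ m) :
    q2Entry (2 * m + 1) w v (2 * a + 2) (2 * b + 1) k l =
      if k = 2 * a + 2 ∧ l = 2 * b + 1 then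
        (7 * v (b + 1) ^ 2 + 4 * w (a + 2) * w (a + 1)) / (2 * w (a + 2) * w (a + 1) * v (b + 1) ^ 2)
      else if k = 2 * a + 3 ∧ l = 2 * b + 1 then -(4 / (w (a + 2) * (w (a + 2) + w (a + 1))))
      else if k = 2 * a + 1 ∧ l = 2 * b + 1 then -(4 / (w (a + 1) * (w (a + 2) + w (a + 1))))
      else if k = 2 * a + 2 ∧ l = 2 * b + 2 then -(1 / v (b + 1) ^ 2)
      else if k = 2 * a + 2 ∧ l = 2 * b then -(1 / v (b + 1) ^ 2)
      else if k = 2 * a + 4 ∧ l = 2 * b + 1 then 1 / (2 * w (a + 2) * (w (a + 2) + w (a + 1)))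
      else if k = 2 * a ∧ l = 2 * b + 1 then 1 / (2 * w (a + 1) * (w (a + 2) + w (a + 1)))
      else 0 := by
  unfold q2Entry
  rw [if_neg (by omega)]
  simp only [show (2 * a + 2) % 2 = 0 by omega, show (2 * b + 1) % 2 = 1 by omega,
    show (2 * a + 2) / 2 = a + 1 by omega,
    show (2 * b + 1 + 1) / 2 = b + 1 by omega,
    if_true, zero_ne_one, if_false, add_assoc, Nat.reduceAdd]
  split_ifs <;> first | rfl | (exfalso; omega)

theorem q2Entry_horizontalEdge (m a b k l : ℕ) (w v : ℕ → ℝ)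
    (ha : a ≤ m) (hb : b < m) :
    q2Entry (2 * m + 1) w v (2 * a + 1) (2 * b + 2) k l =
      if k = 2 * a + 1 ∧ l = 2 * b + 2 then
        (7 * w (a + 1) ^ 2 + 4 * v (b + 2) * v (b + 1)) / (2 * v (b + 2) * v (b + 1) * w (a + 1) ^ 2)
      else if k = 2 * a + 1 ∧ l = 2 * b + 3 then -(4 / (v (b + 2) * (v (b + 2) + v (b + 1))))
      else if k = 2 * a + 1 ∧ l = 2 * b + 1 then -(4 / (v (b + 1) * (v (b + 2) + v (b + 1))))
      else if k = 2 * a + 2 ∧ l = 2 * b + 2 then -(1 / w (a + 1) ^ 2)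
      else if k = 2 * a ∧ l = 2 * b + 2 then -(1 / w (a + 1) ^ 2)
      else if k = 2 * a + 1 ∧ l = 2 * b + 4 then 1 / (2 * v (b + 2) * (v (b + 2) + v (b + 1)))
      else if k = 2 * a + 1 ∧ l = 2 * b then 1 / (2 * v (b + 1) * (v (b + 2) + v (b + 1)))
      else 0 := by
  unfold q2Entry
  rw [if_neg (by omega)]
  simp only [show (2 * a + 1) % 2 = 1 by omega, show (2 * b + 2) % 2 = 0 by omega,
    show (2 * a + 1 + 1) / 2 = a + 1 by omega,
    show (2 * b + 2) / 2 = b + 1 by omega,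
    if_true, zero_ne_one, if_false, add_assoc, Nat.reduceAdd]
  split_ifs <;> first | rfl | (exfalso; omega)

theorem q2Entry_knot (m a b k l : ℕ) (w v : ℕ → ℝ)
    (ha : a < m) (hb : b < m) :
    q2Entry (2 * m + 1) w v (2 * a + 2) (2 * b + 2) k l =
      if k = 2 * a + 2 ∧ l = 2 * b + 2 then
        (7 * w (a + 2) * w (a + 1) + 7 * v (b + 2) * v (b + 1)) / (2 * w (a + 2) * w (a + 1) * v (b + 2) * v (b + 1))
      else if k = 2 * a + 3 ∧ l = 2 * b + 2 then -(4 / (w (a + 2) * (w (a + 2) + w (a + 1))))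
      else if k = 2 * a + 1 ∧ l = 2 * b + 2 then -(4 / (w (a + 1) * (w (a + 2) + w (a + 1))))
      else if k = 2 * a + 2 ∧ l = 2 * b + 3 then -(4 / (v (b + 2) * (v (b + 2) + v (b + 1))))
      else if k = 2 * a + 2 ∧ l = 2 * b + 1 then -(4 / (v (b + 1) * (v (b + 2) + v (b + 1))))
      else if k = 2 * a + 4 ∧ l = 2 * b + 2 then 1 / (2 * w (a + 2) * (w (a + 2) + w (a + 1)))
      else if k = 2 * a ∧ l = 2 * b + 2 then 1 / (2 * w (a + 1) * (w (a + 2) + w (a + 1)))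
      else if k = 2 * a + 2 ∧ l = 2 * b + 4 then 1 / (2 * v (b + 2) * (v (b + 2) + v (b + 1)))
      else if k = 2 * a + 2 ∧ l = 2 * b then 1 / (2 * v (b + 1) * (v (b + 2) + v (b + 1)))
      else 0 := by
  unfold q2Entry
  rw [if_neg (by omega)]
  simp only [show (2 * a + 2) % 2 = 0 by omega, show (2 * b + 2) % 2 = 0 by omega,
    show (2 * a + 2) / 2 = a + 1 by omega,
    show (2 * b + 2) / 2 = b + 1 by omega,
    zero_ne_one, if_false, add_assoc, Nat.reduceAdd,
    show k + 2 = 2 * a + 2 ↔ k = 2 * a by omega, show l + 2 = 2 * b + 2 ↔ l = 2 * b by omega,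
    show k + 1 = 2 * a + 2 ↔ k = 2 * a + 1 by omega,
    show l + 1 = 2 * b + 2 ↔ l = 2 * b + 1 by omega]

theorem q2Entry_boundary {n i j : ℕ} (k l : ℕ) (w v : ℕ → ℝ)
    (h : i = 0 ∨ i = n + 1 ∨ j = 0 ∨ j = n + 1) :
    q2Entry n w v i j k l = if k = i ∧ l = j then 1 else 0 :=
  if_pos h

open Matrix in
theorem q2Matrix_mulVec_eq_sum {n : ℕ} (w v : ℕ → ℝ) (e : ℕ → ℝ)
    (p : Fin (n + 2) × Fin (n + 2)) (T : Finset (ℕ × ℕ))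
    (hT : ∀ z ∈ T, z.1 < n + 2 ∧ z.2 < n + 2)
    (hT0 : ∀ k l, (k, l) ∉ T → q2Entry n w v p.1 p.2 k l = 0) :
    (q2Matrix n w v *ᵥ fun q => e q.1) p =
      ∑ z ∈ T, q2Entry n w v p.1 p.2 z.1 z.2 * e z.1 := by
  have h1 : (q2Matrix n w v *ᵥ fun q => e q.1) p =
      ∑ z ∈ Finset.range (n + 2) ×ˢ Finset.range (n + 2),
        q2Entry n w v p.1 p.2 z.1 z.2 * e z.1 := by
    simp only [mulVec, dotProduct, q2Matrix]
    rw [Fintype.sum_prod_type, Finset.sum_product, Finset.sum_range]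
    exact Finset.sum_congr rfl fun k _ =>
      (Finset.sum_range fun l => q2Entry n w v p.1 p.2 k l * e k).symm
  rw [h1]
  refine (Finset.sum_subset (fun z hz => ?_) fun z _ hz => ?_).symm
  · simpa using hT z hz
  · rw [hT0 z.1 z.2 hz, zero_mul]

/-- The abscissa of the `k`-th grid line. -/
noncomputable def gridAbscissa (w : ℕ → ℝ) (k : ℕ) : ℝ :=
  ∑ r ∈ Finset.range k, w (r / 2 + 1)

theorem gridAbscissa_odd (w : ℕ → ℝ) (a : ℕ) :
    gridAbscissa w (2 * a + 1) = gridAbscissa w (2 * a) + w (a + 1) := by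
  rw [gridAbscissa, Finset.sum_range_succ, Nat.mul_div_cancel_left a two_pos]; rfl

theorem gridAbscissa_even (w : ℕ → ℝ) (a : ℕ) :
    gridAbscissa w (2 * a + 2) = gridAbscissa w (2 * a + 1) + w (a + 1) := by
  rw [gridAbscissa, Finset.sum_range_succ, show (2 * a + 1) / 2 = a by omega]; rfl

open Matrix in
theorem q2Matrix_mulVec_quadratic_center {m a b : ℕ} (w v : ℕ → ℝ) (C : ℝ)
    (ha : a ≤ m) (hb : b ≤ m) (hw1 : 0 < w (a + 1)) (hv1 : 0 < v (b + 1))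
    (p : Fin (2 * m + 1 + 2) × Fin (2 * m + 1 + 2))
    (hp1 : p.1.val = 2 * a + 1) (hp2 : p.2.val = 2 * b + 1) :
    (q2Matrix (2 * m + 1) w v *ᵥ fun q => C - gridAbscissa w q.1 ^ 2) p = 2 := by
  rw [q2Matrix_mulVec_eq_sum w v (fun k => C - gridAbscissa w k ^ 2) p
    {(2 * a + 1, 2 * b + 1), (2 * a + 2, 2 * b + 1), (2 * a, 2 * b + 1), (2 * a + 1, 2 * b + 2),
     (2 * a + 1, 2 * b)}
    (by simp only [Finset.mem_insert, Finset.mem_singleton]; rintro ⟨z1, z2⟩ hz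
        simp only [Prod.mk.injEq] at hz ⊢; omega)
    (by intro k l hkl
        simp only [Finset.mem_insert, Finset.mem_singleton, Prod.mk.injEq, not_or] at hkl
        rw [hp1, hp2, q2Entry_center m a b k l w v ha hb]
        simp only [hkl, if_false])]
  rw [hp1, hp2]
  simp only [q2Entry_center m a b _ _ w v ha hb]
  simp [Finset.sum_insert, gridAbscissa_even, gridAbscissa_odd]
  field_simp
  ring

open Matrix in
theorem q2Matrix_mulVec_quadratic_verticalEdge {m a b : ℕ} (w v : ℕ → ℝ) (C : ℝ)
    (ha : a < m) (hb : b ≤ m) (hw1 : 0 < w (a + 1)) (hv1 : 0 < v (b + 1)) (hw2 : 0 < w (a + 2))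
    (p : Fin (2 * m + 1 + 2) × Fin (2 * m + 1 + 2))
    (hp1 : p.1.val = 2 * a + 2) (hp2 : p.2.val = 2 * b + 1) :
    (q2Matrix (2 * m + 1) w v *ᵥ fun q => C - gridAbscissa w q.1 ^ 2) p = 2 := by
  rw [q2Matrix_mulVec_eq_sum w v (fun k => C - gridAbscissa w k ^ 2) p
    {(2 * a + 2, 2 * b + 1), (2 * a + 3, 2 * b + 1), (2 * a + 1, 2 * b + 1),
      (2 * a + 2, 2 * b + 2), (2 * a + 2, 2 * b), (2 * a + 4, 2 * b + 1), (2 * a, 2 * b + 1)}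
    (by simp only [Finset.mem_insert, Finset.mem_singleton]; rintro ⟨z1, z2⟩ hz
        simp only [Prod.mk.injEq] at hz ⊢; omega)
    (by intro k l hkl
        simp only [Finset.mem_insert, Finset.mem_singleton, Prod.mk.injEq, not_or] at hkl
        rw [hp1, hp2, q2Entry_verticalEdge m a b k l w v ha hb]
        simp only [hkl, if_false])]
  rw [hp1, hp2]
  simp only [q2Entry_verticalEdge m a b _ _ w v ha hb]
  have hx3 : gridAbscissa w (2 * a + 3) = gridAbscissa w (2 * a + 2) + w (a + 2) :=
    gridAbscissa_odd w (a + 1)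
  have hx4 : gridAbscissa w (2 * a + 4) = gridAbscissa w (2 * a + 3) + w (a + 2) :=
    gridAbscissa_even w (a + 1)
  simp [Finset.sum_insert, hx4, hx3, gridAbscissa_even, gridAbscissa_odd]
  field_simp
  ring

open Matrix in
theorem q2Matrix_mulVec_quadratic_horizontalEdge {m a b : ℕ} (w v : ℕ → ℝ) (C : ℝ)
    (ha : a ≤ m) (hb : b < m) (hw1 : 0 < w (a + 1)) (hv1 : 0 < v (b + 1)) (hv2 : 0 < v (b + 2))
    (p : Fin (2 * m + 1 + 2) × Fin (2 * m + 1 + 2))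
    (hp1 : p.1.val = 2 * a + 1) (hp2 : p.2.val = 2 * b + 2) :
    (q2Matrix (2 * m + 1) w v *ᵥ fun q => C - gridAbscissa w q.1 ^ 2) p = 2 := by
  rw [q2Matrix_mulVec_eq_sum w v (fun k => C - gridAbscissa w k ^ 2) p
    {(2 * a + 1, 2 * b + 2), (2 * a + 1, 2 * b + 3), (2 * a + 1, 2 * b + 1),
      (2 * a + 2, 2 * b + 2), (2 * a, 2 * b + 2), (2 * a + 1, 2 * b + 4), (2 * a + 1, 2 * b)}
    (by simp only [Finset.mem_insert, Finset.mem_singleton]; rintro ⟨z1, z2⟩ hz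
        simp only [Prod.mk.injEq] at hz ⊢; omega)
    (by intro k l hkl
        simp only [Finset.mem_insert, Finset.mem_singleton, Prod.mk.injEq, not_or] at hkl
        rw [hp1, hp2, q2Entry_horizontalEdge m a b k l w v ha hb]
        simp only [hkl, if_false])]
  rw [hp1, hp2]
  simp only [q2Entry_horizontalEdge m a b _ _ w v ha hb]
  simp [Finset.sum_insert, gridAbscissa_even, gridAbscissa_odd]
  field_simp
  ring

open Matrix in
theorem q2Matrix_mulVec_quadratic_knot {m a b : ℕ} (w v : ℕ → ℝ) (C : ℝ)
    (ha : a < m) (hb : b < m) (hw1 : 0 < w (a + 1)) (hv1 : 0 < v (b + 1)) (hw2 : 0 < w (a + 2))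
    (hv2 : 0 < v (b + 2))
    (p : Fin (2 * m + 1 + 2) × Fin (2 * m + 1 + 2))
    (hp1 : p.1.val = 2 * a + 2) (hp2 : p.2.val = 2 * b + 2) :
    (q2Matrix (2 * m + 1) w v *ᵥ fun q => C - gridAbscissa w q.1 ^ 2) p = 2 := by
  rw [q2Matrix_mulVec_eq_sum w v (fun k => C - gridAbscissa w k ^ 2) p
    {(2 * a + 2, 2 * b + 2), (2 * a + 3, 2 * b + 2), (2 * a + 1, 2 * b + 2),
      (2 * a + 2, 2 * b + 3), (2 * a + 2, 2 * b + 1), (2 * a + 4, 2 * b + 2), (2 * a, 2 * b + 2),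
      (2 * a + 2, 2 * b + 4), (2 * a + 2, 2 * b)}
    (by simp only [Finset.mem_insert, Finset.mem_singleton]; rintro ⟨z1, z2⟩ hz
        simp only [Prod.mk.injEq] at hz ⊢; omega)
    (by intro k l hkl
        simp only [Finset.mem_insert, Finset.mem_singleton, Prod.mk.injEq, not_or] at hkl
        rw [hp1, hp2, q2Entry_knot m a b k l w v ha hb]
        simp only [hkl, if_false])]
  rw [hp1, hp2]
  simp only [q2Entry_knot m a b _ _ w v ha hb]
  have hx3 : gridAbscissa w (2 * a + 3) = gridAbscissa w (2 * a + 2) + w (a + 2) :=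
    gridAbscissa_odd w (a + 1)
  have hx4 : gridAbscissa w (2 * a + 4) = gridAbscissa w (2 * a + 3) + w (a + 2) :=
    gridAbscissa_even w (a + 1)
  simp [Finset.sum_insert, hx4, hx3, gridAbscissa_even, gridAbscissa_odd]
  field_simp
  ring

/-- Domination of the positive entry of an edge center row by a path through a cell center. -/
theorem edge_path_le {h g s : ℝ} (hh : 0 < h) (hg : 0 < g) (hs : 0 < s)
    (hle : h ^ 2 ≤ 3 * g ^ 2) :
    1 / (2 * h * s) * ((2 * h ^ 2 + 2 * g ^ 2) / (h ^ 2 * g ^ 2)) ≤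
      -(4 / (h * s)) * -(1 / h ^ 2) := by
  rw [← sub_nonneg]
  have : -(4 / (h * s)) * -(1 / h ^ 2) -
      1 / (2 * h * s) * ((2 * h ^ 2 + 2 * g ^ 2) / (h ^ 2 * g ^ 2)) =
      (3 * g ^ 2 - h ^ 2) / (h ^ 3 * s * g ^ 2) := by
    field_simp
    ring
  rw [this]
  exact div_nonneg (by linarith) (by positivity)

/-- Domination of the positive entry of a knot row by a path through an edge center. -/
theorem knot_path_le {h g g' s : ℝ} (hh : 0 < h) (hg : 0 < g) (hg' : 0 < g') (hs : 0 < s)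
    (hle : 7 * h ^ 2 ≤ 12 * (g * g')) :
    1 / (2 * h * s) * ((7 * h ^ 2 + 4 * g * g') / (2 * g * g' * h ^ 2)) ≤
      -(4 / (h * s)) * -(1 / h ^ 2) := by
  rw [← sub_nonneg]
  have : -(4 / (h * s)) * -(1 / h ^ 2) -
      1 / (2 * h * s) * ((7 * h ^ 2 + 4 * g * g') / (2 * g * g' * h ^ 2)) =
      (12 * (g * g') - 7 * h ^ 2) / (4 * h ^ 3 * s * g * g') := by
    field_simp
    ring
  rw [this]
  exact div_nonneg (by linarith) (by positivity)

theorem grid_index_cases {m i j : ℕ} (hi : i < 2 * m + 1 + 2) (hj : j < 2 * m + 1 + 2) :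
    (i = 0 ∨ i = 2 * m + 1 + 1 ∨ j = 0 ∨ j = 2 * m + 1 + 1) ∨
    (∃ a b, a ≤ m ∧ b ≤ m ∧ i = 2 * a + 1 ∧ j = 2 * b + 1) ∨
    (∃ a b, a < m ∧ b ≤ m ∧ i = 2 * a + 2 ∧ j = 2 * b + 1) ∨
    (∃ a b, a ≤ m ∧ b < m ∧ i = 2 * a + 1 ∧ j = 2 * b + 2) ∨
    (∃ a b, a < m ∧ b < m ∧ i = 2 * a + 2 ∧ j = 2 * b + 2) := by
  by_cases hbd : i = 0 ∨ i = 2 * m + 1 + 1 ∨ j = 0 ∨ j = 2 * m + 1 + 1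
  · exact Or.inl hbd
  right
  rcases Nat.mod_two_eq_zero_or_one i with h1 | h1 <;>
    rcases Nat.mod_two_eq_zero_or_one j with h2 | h2
  · exact Or.inr <| Or.inr <| Or.inr ⟨i / 2 - 1, j / 2 - 1, by omega⟩
  · exact Or.inr <| Or.inl ⟨i / 2 - 1, j / 2, by omega⟩
  · exact Or.inr <| Or.inr <| Or.inl ⟨i / 2, j / 2 - 1, by omega⟩
  · exact Or.inl ⟨i / 2, j / 2, by omega⟩

section Entries

variable {m : ℕ} {w v : ℕ → ℝ}

theorem q2Entry_diag_pos (hw : ∀ a ≤ m, 0 < w (a + 1)) (hv : ∀ b ≤ m, 0 < v (b + 1))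
    {i j : ℕ} (hi : i < 2 * m + 1 + 2) (hj : j < 2 * m + 1 + 2) :
    0 < q2Entry (2 * m + 1) w v i j i j := by
  rcases grid_index_cases hi hj with h | ⟨a, b, ha, hb, rfl, rfl⟩ | ⟨a, b, ha, hb, rfl, rfl⟩ |
    ⟨a, b, ha, hb, rfl, rfl⟩ | ⟨a, b, ha, hb, rfl, rfl⟩
  · simp [q2Entry_boundary _ _ _ _ h]
  · have hw1 := hw a ha
    have hv1 := hv b hb
    rw [q2Entry_center m a b _ _ w v ha hb, if_pos ⟨rfl, rfl⟩]
    positivity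
  · have hw1 := hw a ha.le
    have hv1 := hv b hb
    have hw2 : 0 < w (a + 2) := hw (a + 1) ha
    rw [q2Entry_verticalEdge m a b _ _ w v ha hb, if_pos ⟨rfl, rfl⟩]
    positivity
  · have hw1 := hw a ha
    have hv1 := hv b hb.le
    have hv2 : 0 < v (b + 2) := hv (b + 1) hb
    rw [q2Entry_horizontalEdge m a b _ _ w v ha hb, if_pos ⟨rfl, rfl⟩]
    positivity
  · have hw1 := hw a ha.le
    have hv1 := hv b hb.le
    have hw2 : 0 < w (a + 2) := hw (a + 1) ha
    have hv2 : 0 < v (b + 2) := hv (b + 1) hb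
    rw [q2Entry_knot m a b _ _ w v ha hb, if_pos ⟨rfl, rfl⟩]
    positivity

theorem q2Entry_nonpos_of_parity_ne (hw : ∀ a ≤ m, 0 < w (a + 1))
    (hv : ∀ b ≤ m, 0 < v (b + 1)) {i j k l : ℕ} (hi : i < 2 * m + 1 + 2)
    (hj : j < 2 * m + 1 + 2) (hne : i % 2 + j % 2 ≠ k % 2 + l % 2) :
    q2Entry (2 * m + 1) w v i j k l ≤ 0 := by
  rcases grid_index_cases hi hj with h | ⟨a, b, ha, hb, rfl, rfl⟩ | ⟨a, b, ha, hb, rfl, rfl⟩ |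
    ⟨a, b, ha, hb, rfl, rfl⟩ | ⟨a, b, ha, hb, rfl, rfl⟩
  · rw [q2Entry_boundary _ _ _ _ h, if_neg]
    rintro ⟨rfl, rfl⟩
    exact hne rfl
  · have hw1 := hw a ha
    have hv1 := hv b hb
    rw [q2Entry_center m a b _ _ w v ha hb]
    split_ifs <;> first
      | exact le_rfl
      | (exfalso; omega)
      | exact neg_nonpos.2 (by positivity)
  · have hw1 := hw a ha.le
    have hv1 := hv b hb
    have hw2 : 0 < w (a + 2) := hw (a + 1) ha
    rw [q2Entry_verticalEdge m a b _ _ w v ha hb]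
    split_ifs <;> first
      | exact le_rfl
      | (exfalso; omega)
      | exact neg_nonpos.2 (by positivity)
  · have hw1 := hw a ha
    have hv1 := hv b hb.le
    have hv2 : 0 < v (b + 2) := hv (b + 1) hb
    rw [q2Entry_horizontalEdge m a b _ _ w v ha hb]
    split_ifs <;> first
      | exact le_rfl
      | (exfalso; omega)
      | exact neg_nonpos.2 (by positivity)
  · have hw1 := hw a ha.le
    have hv1 := hv b hb.le
    have hw2 : 0 < w (a + 2) := hw (a + 1) ha
    have hv2 : 0 < v (b + 2) := hv (b + 1) hb
    rw [q2Entry_knot m a b _ _ w v ha hb]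
    split_ifs <;> first
      | exact le_rfl
      | (exfalso; omega)
      | exact neg_nonpos.2 (by positivity)

theorem q2Entry_nonpos_or_path (hw : ∀ a ≤ m, 0 < w (a + 1)) (hv : ∀ b ≤ m, 0 < v (b + 1))
    (hknot : ∀ a b, a < m → b < m →
      (7 * w (a + 1) ^ 2 ≤ 12 * (v (b + 2) * v (b + 1)) ∧
        7 * w (a + 2) ^ 2 ≤ 12 * (v (b + 2) * v (b + 1))) ∧
      7 * v (b + 1) ^ 2 ≤ 12 * (w (a + 2) * w (a + 1)) ∧
        7 * v (b + 2) ^ 2 ≤ 12 * (w (a + 2) * w (a + 1)))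
    (hedge : ∀ a b, a ≤ m → b ≤ m → w (a + 1) ^ 2 ≤ 3 * v (b + 1) ^ 2 ∧
      v (b + 1) ^ 2 ≤ 3 * w (a + 1) ^ 2)
    {i j k l : ℕ} (hi : i < 2 * m + 1 + 2) (hj : j < 2 * m + 1 + 2)
    (hne : ¬(k = i ∧ l = j)) (hpar : i % 2 + j % 2 = k % 2 + l % 2) :
    q2Entry (2 * m + 1) w v i j k l ≤ 0 ∨
      ∃ r s, r < 2 * m + 1 + 2 ∧ s < 2 * m + 1 + 2 ∧ i % 2 + j % 2 < r % 2 + s % 2 ∧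
        q2Entry (2 * m + 1) w v i j k l * q2Entry (2 * m + 1) w v r s r s ≤
          q2Entry (2 * m + 1) w v i j r s * q2Entry (2 * m + 1) w v r s k l := by
  rcases grid_index_cases hi hj with h | ⟨a, b, ha, hb, rfl, rfl⟩ | ⟨a, b, ha, hb, rfl, rfl⟩ |
    ⟨a, b, ha, hb, rfl, rfl⟩ | ⟨a, b, ha, hb, rfl, rfl⟩
  · exact Or.inl (by rw [q2Entry_boundary _ _ _ _ h, if_neg hne])
  · left
    rw [q2Entry_center m a b _ _ w v ha hb]
    split_ifs <;> first
      | exact le_rfl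
      | (exfalso; omega)
  · have hw1 := hw a ha.le
    have hv1 := hv b hb
    have hw2 : 0 < w (a + 2) := hw (a + 1) ha
    by_cases h : k = 2 * a + 4 ∧ l = 2 * b + 1
    · obtain ⟨rfl, rfl⟩ := h
      have e1 : q2Entry (2 * m + 1) w v (2 * a + 2) (2 * b + 1) (2 * a + 4) (2 * b + 1) =
          1 / (2 * w (a + 2) * (w (a + 2) + w (a + 1))) := by
        rw [q2Entry_verticalEdge m a b _ _ w v ha hb]; simp
      have e2 : q2Entry (2 * m + 1) w v (2 * a + 3) (2 * b + 1) (2 * a + 3) (2 * b + 1) =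
          (2 * w (a + 2) ^ 2 + 2 * v (b + 1) ^ 2) / (w (a + 2) ^ 2 * v (b + 1) ^ 2) := by
        rw [show 2 * a + 3 = 2 * (a + 1) + 1 by ring, q2Entry_center m (a + 1) b _ _ w v ha hb,
          if_pos ⟨rfl, rfl⟩]
      have e3 : q2Entry (2 * m + 1) w v (2 * a + 2) (2 * b + 1) (2 * a + 3) (2 * b + 1) =
          -(4 / (w (a + 2) * (w (a + 2) + w (a + 1)))) := by
        rw [q2Entry_verticalEdge m a b _ _ w v ha hb]; simp
      have e4 : q2Entry (2 * m + 1) w v (2 * a + 3) (2 * b + 1) (2 * a + 4) (2 * b + 1) =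
          -(1 / w (a + 2) ^ 2) := by
        rw [show 2 * a + 3 = 2 * (a + 1) + 1 by ring,
          q2Entry_center m (a + 1) b _ _ w v ha hb]; simp [mul_add]
      refine Or.inr ⟨2 * a + 3, 2 * b + 1, by omega, by omega, by omega, ?_⟩
      rw [e1, e2, e3, e4]
      exact edge_path_le hw2 hv1 (add_pos hw2 hw1) (hedge (a + 1) b ha hb).1
    by_cases h : k = 2 * a ∧ l = 2 * b + 1
    · obtain ⟨rfl, rfl⟩ := h
      have e1 : q2Entry (2 * m + 1) w v (2 * a + 2) (2 * b + 1) (2 * a) (2 * b + 1) =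
          1 / (2 * w (a + 1) * (w (a + 2) + w (a + 1))) := by
        rw [q2Entry_verticalEdge m a b _ _ w v ha hb]; simp
      have e2 : q2Entry (2 * m + 1) w v (2 * a + 1) (2 * b + 1) (2 * a + 1) (2 * b + 1) =
          (2 * w (a + 1) ^ 2 + 2 * v (b + 1) ^ 2) / (w (a + 1) ^ 2 * v (b + 1) ^ 2) := by
        rw [q2Entry_center m a b _ _ w v ha.le hb, if_pos ⟨rfl, rfl⟩]
      have e3 : q2Entry (2 * m + 1) w v (2 * a + 2) (2 * b + 1) (2 * a + 1) (2 * b + 1) =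
          -(4 / (w (a + 1) * (w (a + 2) + w (a + 1)))) := by
        rw [q2Entry_verticalEdge m a b _ _ w v ha hb]; simp
      have e4 : q2Entry (2 * m + 1) w v (2 * a + 1) (2 * b + 1) (2 * a) (2 * b + 1) =
          -(1 / w (a + 1) ^ 2) := by
        rw [q2Entry_center m a b _ _ w v ha.le hb]; simp
      refine Or.inr ⟨2 * a + 1, 2 * b + 1, by omega, by omega, by omega, ?_⟩
      rw [e1, e2, e3, e4]
      exact edge_path_le hw1 hv1 (add_pos hw2 hw1) (hedge a b ha.le hb).1
    left
    rw [q2Entry_verticalEdge m a b _ _ w v ha hb]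
    split_ifs <;> first
      | exact le_rfl
      | (exfalso; omega)
  · have hw1 := hw a ha
    have hv1 := hv b hb.le
    have hv2 : 0 < v (b + 2) := hv (b + 1) hb
    by_cases h : k = 2 * a + 1 ∧ l = 2 * b + 4
    · obtain ⟨rfl, rfl⟩ := h
      have e1 : q2Entry (2 * m + 1) w v (2 * a + 1) (2 * b + 2) (2 * a + 1) (2 * b + 4) =
          1 / (2 * v (b + 2) * (v (b + 2) + v (b + 1))) := by
        rw [q2Entry_horizontalEdge m a b _ _ w v ha hb]; simp
      have e2 : q2Entry (2 * m + 1) w v (2 * a + 1) (2 * b + 3) (2 * a + 1) (2 * b + 3) =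
          (2 * w (a + 1) ^ 2 + 2 * v (b + 2) ^ 2) / (w (a + 1) ^ 2 * v (b + 2) ^ 2) := by
        rw [show 2 * b + 3 = 2 * (b + 1) + 1 by ring, q2Entry_center m a (b + 1) _ _ w v ha hb,
          if_pos ⟨rfl, rfl⟩]
      have e3 : q2Entry (2 * m + 1) w v (2 * a + 1) (2 * b + 2) (2 * a + 1) (2 * b + 3) =
          -(4 / (v (b + 2) * (v (b + 2) + v (b + 1)))) := by
        rw [q2Entry_horizontalEdge m a b _ _ w v ha hb]; simp
      have e4 : q2Entry (2 * m + 1) w v (2 * a + 1) (2 * b + 3) (2 * a + 1) (2 * b + 4) =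
          -(1 / v (b + 2) ^ 2) := by
        rw [show 2 * b + 3 = 2 * (b + 1) + 1 by ring,
          q2Entry_center m a (b + 1) _ _ w v ha hb]; simp [mul_add]
      refine Or.inr ⟨2 * a + 1, 2 * b + 3, by omega, by omega, by omega, ?_⟩
      rw [e1, e2, e3, e4]
      exact (le_of_eq (by ring)).trans
        (edge_path_le hv2 hw1 (add_pos hv2 hv1) (hedge a (b + 1) ha hb).2)
    by_cases h : k = 2 * a + 1 ∧ l = 2 * b
    · obtain ⟨rfl, rfl⟩ := h
      have e1 : q2Entry (2 * m + 1) w v (2 * a + 1) (2 * b + 2) (2 * a + 1) (2 * b) =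
          1 / (2 * v (b + 1) * (v (b + 2) + v (b + 1))) := by
        rw [q2Entry_horizontalEdge m a b _ _ w v ha hb]; simp
      have e2 : q2Entry (2 * m + 1) w v (2 * a + 1) (2 * b + 1) (2 * a + 1) (2 * b + 1) =
          (2 * w (a + 1) ^ 2 + 2 * v (b + 1) ^ 2) / (w (a + 1) ^ 2 * v (b + 1) ^ 2) := by
        rw [q2Entry_center m a b _ _ w v ha hb.le, if_pos ⟨rfl, rfl⟩]
      have e3 : q2Entry (2 * m + 1) w v (2 * a + 1) (2 * b + 2) (2 * a + 1) (2 * b + 1) =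
          -(4 / (v (b + 1) * (v (b + 2) + v (b + 1)))) := by
        rw [q2Entry_horizontalEdge m a b _ _ w v ha hb]; simp
      have e4 : q2Entry (2 * m + 1) w v (2 * a + 1) (2 * b + 1) (2 * a + 1) (2 * b) =
          -(1 / v (b + 1) ^ 2) := by
        rw [q2Entry_center m a b _ _ w v ha hb.le]; simp
      refine Or.inr ⟨2 * a + 1, 2 * b + 1, by omega, by omega, by omega, ?_⟩
      rw [e1, e2, e3, e4]
      exact (le_of_eq (by ring)).trans
        (edge_path_le hv1 hw1 (add_pos hv2 hv1) (hedge a b ha hb.le).2)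
    left
    rw [q2Entry_horizontalEdge m a b _ _ w v ha hb]
    split_ifs <;> first
      | exact le_rfl
      | (exfalso; omega)
  · have hw1 := hw a ha.le
    have hv1 := hv b hb.le
    have hw2 : 0 < w (a + 2) := hw (a + 1) ha
    have hv2 : 0 < v (b + 2) := hv (b + 1) hb
    by_cases h : k = 2 * a + 4 ∧ l = 2 * b + 2
    · obtain ⟨rfl, rfl⟩ := h
      have e1 : q2Entry (2 * m + 1) w v (2 * a + 2) (2 * b + 2) (2 * a + 4) (2 * b + 2) =
          1 / (2 * w (a + 2) * (w (a + 2) + w (a + 1))) := by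
        rw [q2Entry_knot m a b _ _ w v ha hb]; simp
      have e2 : q2Entry (2 * m + 1) w v (2 * a + 3) (2 * b + 2) (2 * a + 3) (2 * b + 2) =
          (7 * w (a + 2) ^ 2 + 4 * v (b + 2) * v (b + 1)) /
            (2 * v (b + 2) * v (b + 1) * w (a + 2) ^ 2) := by
        rw [show 2 * a + 3 = 2 * (a + 1) + 1 by ring,
          q2Entry_horizontalEdge m (a + 1) b _ _ w v ha hb, if_pos ⟨rfl, rfl⟩]
      have e3 : q2Entry (2 * m + 1) w v (2 * a + 2) (2 * b + 2) (2 * a + 3) (2 * b + 2) =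
          -(4 / (w (a + 2) * (w (a + 2) + w (a + 1)))) := by
        rw [q2Entry_knot m a b _ _ w v ha hb]; simp
      have e4 : q2Entry (2 * m + 1) w v (2 * a + 3) (2 * b + 2) (2 * a + 4) (2 * b + 2) =
          -(1 / w (a + 2) ^ 2) := by
        rw [show 2 * a + 3 = 2 * (a + 1) + 1 by ring,
          q2Entry_horizontalEdge m (a + 1) b _ _ w v ha hb]; simp [mul_add]
      refine Or.inr ⟨2 * a + 3, 2 * b + 2, by omega, by omega, by omega, ?_⟩
      rw [e1, e2, e3, e4]
      exact knot_path_le hw2 hv2 hv1 (add_pos hw2 hw1) (hknot a b ha hb).1.2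
    by_cases h : k = 2 * a ∧ l = 2 * b + 2
    · obtain ⟨rfl, rfl⟩ := h
      have e1 : q2Entry (2 * m + 1) w v (2 * a + 2) (2 * b + 2) (2 * a) (2 * b + 2) =
          1 / (2 * w (a + 1) * (w (a + 2) + w (a + 1))) := by
        rw [q2Entry_knot m a b _ _ w v ha hb]; simp
      have e2 : q2Entry (2 * m + 1) w v (2 * a + 1) (2 * b + 2) (2 * a + 1) (2 * b + 2) =
          (7 * w (a + 1) ^ 2 + 4 * v (b + 2) * v (b + 1)) /
            (2 * v (b + 2) * v (b + 1) * w (a + 1) ^ 2) := by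
        rw [q2Entry_horizontalEdge m a b _ _ w v ha.le hb, if_pos ⟨rfl, rfl⟩]
      have e3 : q2Entry (2 * m + 1) w v (2 * a + 2) (2 * b + 2) (2 * a + 1) (2 * b + 2) =
          -(4 / (w (a + 1) * (w (a + 2) + w (a + 1)))) := by
        rw [q2Entry_knot m a b _ _ w v ha hb]; simp
      have e4 : q2Entry (2 * m + 1) w v (2 * a + 1) (2 * b + 2) (2 * a) (2 * b + 2) =
          -(1 / w (a + 1) ^ 2) := by
        rw [q2Entry_horizontalEdge m a b _ _ w v ha.le hb]; simp
      refine Or.inr ⟨2 * a + 1, 2 * b + 2, by omega, by omega, by omega, ?_⟩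
      rw [e1, e2, e3, e4]
      exact knot_path_le hw1 hv2 hv1 (add_pos hw2 hw1) (hknot a b ha hb).1.1
    by_cases h : k = 2 * a + 2 ∧ l = 2 * b + 4
    · obtain ⟨rfl, rfl⟩ := h
      have e1 : q2Entry (2 * m + 1) w v (2 * a + 2) (2 * b + 2) (2 * a + 2) (2 * b + 4) =
          1 / (2 * v (b + 2) * (v (b + 2) + v (b + 1))) := by
        rw [q2Entry_knot m a b _ _ w v ha hb]; simp
      have e2 : q2Entry (2 * m + 1) w v (2 * a + 2) (2 * b + 3) (2 * a + 2) (2 * b + 3) =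
          (7 * v (b + 2) ^ 2 + 4 * w (a + 2) * w (a + 1)) /
            (2 * w (a + 2) * w (a + 1) * v (b + 2) ^ 2) := by
        rw [show 2 * b + 3 = 2 * (b + 1) + 1 by ring,
          q2Entry_verticalEdge m a (b + 1) _ _ w v ha hb, if_pos ⟨rfl, rfl⟩]
      have e3 : q2Entry (2 * m + 1) w v (2 * a + 2) (2 * b + 2) (2 * a + 2) (2 * b + 3) =
          -(4 / (v (b + 2) * (v (b + 2) + v (b + 1)))) := by
        rw [q2Entry_knot m a b _ _ w v ha hb]; simp
      have e4 : q2Entry (2 * m + 1) w v (2 * a + 2) (2 * b + 3) (2 * a + 2) (2 * b + 4) =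
          -(1 / v (b + 2) ^ 2) := by
        rw [show 2 * b + 3 = 2 * (b + 1) + 1 by ring,
          q2Entry_verticalEdge m a (b + 1) _ _ w v ha hb]; simp [mul_add]
      refine Or.inr ⟨2 * a + 2, 2 * b + 3, by omega, by omega, by omega, ?_⟩
      rw [e1, e2, e3, e4]
      exact knot_path_le hv2 hw2 hw1 (add_pos hv2 hv1) (hknot a b ha hb).2.2
    by_cases h : k = 2 * a + 2 ∧ l = 2 * b
    · obtain ⟨rfl, rfl⟩ := h
      have e1 : q2Entry (2 * m + 1) w v (2 * a + 2) (2 * b + 2) (2 * a + 2) (2 * b) =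
          1 / (2 * v (b + 1) * (v (b + 2) + v (b + 1))) := by
        rw [q2Entry_knot m a b _ _ w v ha hb]; simp
      have e2 : q2Entry (2 * m + 1) w v (2 * a + 2) (2 * b + 1) (2 * a + 2) (2 * b + 1) =
          (7 * v (b + 1) ^ 2 + 4 * w (a + 2) * w (a + 1)) /
            (2 * w (a + 2) * w (a + 1) * v (b + 1) ^ 2) := by
        rw [q2Entry_verticalEdge m a b _ _ w v ha hb.le, if_pos ⟨rfl, rfl⟩]
      have e3 : q2Entry (2 * m + 1) w v (2 * a + 2) (2 * b + 2) (2 * a + 2) (2 * b + 1) =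
          -(4 / (v (b + 1) * (v (b + 2) + v (b + 1)))) := by
        rw [q2Entry_knot m a b _ _ w v ha hb]; simp
      have e4 : q2Entry (2 * m + 1) w v (2 * a + 2) (2 * b + 1) (2 * a + 2) (2 * b) =
          -(1 / v (b + 1) ^ 2) := by
        rw [q2Entry_verticalEdge m a b _ _ w v ha hb.le]; simp
      refine Or.inr ⟨2 * a + 2, 2 * b + 1, by omega, by omega, by omega, ?_⟩
      rw [e1, e2, e3, e4]
      exact knot_path_le hv1 hw2 hw1 (add_pos hv2 hv1) (hknot a b ha hb).2.1
    left
    rw [q2Entry_knot m a b _ _ w v ha hb]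
    split_ifs <;> first
      | exact le_rfl
      | (exfalso; omega)

end Entries

theorem gridAbscissa_nonneg {m k : ℕ} {w : ℕ → ℝ} (hw : ∀ a ≤ m, 0 < w (a + 1))
    (hk : k ≤ 2 * m + 2) : 0 ≤ gridAbscissa w k :=
  Finset.sum_nonneg fun r hr => (hw (r / 2) (by rw [Finset.mem_range] at hr; omega)).le

theorem gridAbscissa_le {m k : ℕ} {w : ℕ → ℝ} (hw : ∀ a ≤ m, 0 < w (a + 1))
    (hk : k ≤ 2 * m + 2) : gridAbscissa w k ≤ gridAbscissa w (2 * m + 2) :=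
  Finset.sum_le_sum_of_subset_of_nonneg (Finset.range_subset_range.2 hk) fun r hr _ =>
    (hw (r / 2) (by rw [Finset.mem_range] at hr; omega)).le

theorem sq_le_three_mul_sq_of_le {x y : ℝ} (hy : 0 < y) (h : 1 / Real.sqrt 3 * y ≤ x) :
    y ^ 2 ≤ 3 * x ^ 2 := by
  have h3 : (0 : ℝ) < Real.sqrt 3 := by positivity
  have h1 : y ≤ Real.sqrt 3 * x := by
    rw [one_div_mul_eq_div, div_le_iff₀ h3] at h
    linarith
  calc y ^ 2 ≤ (Real.sqrt 3 * x) ^ 2 := pow_le_pow_left₀ hy.le h1 2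
    _ = 3 * x ^ 2 := by rw [mul_pow, Real.sq_sqrt (by norm_num)]

/-- under the stated mesh constraints on the half cell sizes, the `Q²`
variational difference matrix `L̄` is invertible and `L̄⁻¹ ≥ 0` entrywise. -/
theorem stmt9 (n : ℕ) (hn : 3 ≤ n) (hodd : Odd n) (w v : ℕ → ℝ)
    (hw : ∀ p, 1 ≤ p → p ≤ (n + 1) / 2 → 0 < w p)
    (hv : ∀ q, 1 ≤ q → q ≤ (n + 1) / 2 → 0 < v q)
    (hmesh : ∀ p q : ℕ, 1 ≤ p → p + 1 ≤ (n + 1) / 2 → 1 ≤ q → q + 1 ≤ (n + 1) / 2 →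
      w (p + 1) * w p ≥ 7 / 12 * max ((v (q + 1)) ^ 2) ((v q) ^ 2) ∧
      v (q + 1) * v q ≥ 7 / 12 * max ((w (p + 1)) ^ 2) ((w p) ^ 2) ∧
      min (w (p + 1)) (w p) ≥ (1 / Real.sqrt 3) * max (v (q + 1)) (v q) ∧
      min (v (q + 1)) (v q) ≥ (1 / Real.sqrt 3) * max (w (p + 1)) (w p)) :
    IsUnit (q2Matrix n w v) ∧ ∀ p q, 0 ≤ (q2Matrix n w v)⁻¹ p q := by
  obtain ⟨m, rfl⟩ := hodd
  have hP : (2 * m + 1 + 1) / 2 = m + 1 := by omega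
  rw [hP] at hw hv hmesh
  have hw' : ∀ a ≤ m, 0 < w (a + 1) := fun a ha => hw _ (by omega) (by omega)
  have hv' : ∀ b ≤ m, 0 < v (b + 1) := fun b hb => hv _ (by omega) (by omega)
  have hknot : ∀ a b, a < m → b < m →
      (7 * w (a + 1) ^ 2 ≤ 12 * (v (b + 2) * v (b + 1)) ∧
        7 * w (a + 2) ^ 2 ≤ 12 * (v (b + 2) * v (b + 1))) ∧
      7 * v (b + 1) ^ 2 ≤ 12 * (w (a + 2) * w (a + 1)) ∧
        7 * v (b + 2) ^ 2 ≤ 12 * (w (a + 2) * w (a + 1)) := by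
    intro a b ha hb
    obtain ⟨h1, h2, -, -⟩ :=
      hmesh (a + 1) (b + 1) (by omega) (by omega) (by omega) (by omega)
    simp only [add_assoc, Nat.reduceAdd] at h1 h2
    have h3 := le_max_left (v (b + 2) ^ 2) (v (b + 1) ^ 2)
    have h4 := le_max_right (v (b + 2) ^ 2) (v (b + 1) ^ 2)
    have h5 := le_max_left (w (a + 2) ^ 2) (w (a + 1) ^ 2)
    have h6 := le_max_right (w (a + 2) ^ 2) (w (a + 1) ^ 2)
    refine ⟨⟨?_, ?_⟩, ?_, ?_⟩ <;> linarith
  have hratio : ∀ a b, a < m → b < m → ∀ c d, (c = a ∨ c = a + 1) → (d = b ∨ d = b + 1) →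
      w (c + 1) ^ 2 ≤ 3 * v (d + 1) ^ 2 ∧ v (d + 1) ^ 2 ≤ 3 * w (c + 1) ^ 2 := by
    intro a b ha hb c d hc hd
    obtain ⟨-, -, h3, h4⟩ :=
      hmesh (a + 1) (b + 1) (by omega) (by omega) (by omega) (by omega)
    have hs : 0 ≤ 1 / Real.sqrt 3 := by positivity
    have hwmem : min (w (a + 1 + 1)) (w (a + 1)) ≤ w (c + 1) ∧
        w (c + 1) ≤ max (w (a + 1 + 1)) (w (a + 1)) := by
      rcases hc with rfl | rfl <;> simp
    have hvmem : min (v (b + 1 + 1)) (v (b + 1)) ≤ v (d + 1) ∧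
        v (d + 1) ≤ max (v (b + 1 + 1)) (v (b + 1)) := by
      rcases hd with rfl | rfl <;> simp
    exact ⟨sq_le_three_mul_sq_of_le (hw' c (by omega))
        ((mul_le_mul_of_nonneg_left hwmem.2 hs).trans (h4.le.trans hvmem.1)),
      sq_le_three_mul_sq_of_le (hv' d (by omega))
        ((mul_le_mul_of_nonneg_left hvmem.2 hs).trans (h3.le.trans hwmem.1))⟩
  have hedge : ∀ a b, a ≤ m → b ≤ m → w (a + 1) ^ 2 ≤ 3 * v (b + 1) ^ 2 ∧
      v (b + 1) ^ 2 ≤ 3 * w (a + 1) ^ 2 := fun a b ha hb =>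
    hratio (min a (m - 1)) (min b (m - 1)) (by omega) (by omega) a b (by omega) (by omega)
  refine isUnit_and_inv_nonneg_of_graded (q2Matrix (2 * m + 1) w v)
    (fun p => p.1.val % 2 + p.2.val % 2)
    (fun q => gridAbscissa w (2 * m + 2) ^ 2 + 1 - gridAbscissa w q.1 ^ 2)
    (fun p => by omega) (fun p => q2Entry_diag_pos hw' hv' p.1.2 p.2.2)
    (fun p q h => q2Entry_nonpos_of_parity_ne hw' hv' p.1.2 p.2.2 h)
    (fun p q hpq h => ?_) ?_ (fun p => ?_)
  · rcases q2Entry_nonpos_or_path hw' hv' hknot hedge p.1.2 p.2.2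
      (k := q.1) (l := q.2) (fun h' => hpq (Prod.ext (Fin.ext h'.1.symm) (Fin.ext h'.2.symm))) h
      with h0 | ⟨r, s, hr, hs, hlt, hle⟩
    · exact Or.inl h0
    · exact Or.inr ⟨(⟨r, hr⟩, ⟨s, hs⟩), hlt, hle⟩
  · have hpos : ∀ k ≤ 2 * m + 2,
        0 < gridAbscissa w (2 * m + 2) ^ 2 + 1 - gridAbscissa w k ^ 2 := fun k hk => by
      have := pow_le_pow_left₀ (gridAbscissa_nonneg hw' hk) (gridAbscissa_le hw' hk) 2
      linarith
    exact fun p => hpos _ (by omega)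
  · rcases grid_index_cases p.1.2 p.2.2 with h | ⟨a, b, ha, hb, h1, h2⟩ |
      ⟨a, b, ha, hb, h1, h2⟩ | ⟨a, b, ha, hb, h1, h2⟩ | ⟨a, b, ha, hb, h1, h2⟩
    · rw [q2Matrix_mulVec_eq_sum w v
        (fun k => gridAbscissa w (2 * m + 2) ^ 2 + 1 - gridAbscissa w k ^ 2) p {(p.1.val, p.2.val)}
        (by simp) (fun k l hkl => by
          rw [q2Entry_boundary _ _ _ _ h, if_neg]
          simpa using hkl)]
      have := pow_le_pow_left₀ (gridAbscissa_nonneg hw' (k := p.1) (by omega))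
        (gridAbscissa_le hw' (by omega)) 2
      rw [Finset.sum_singleton, q2Entry_boundary _ _ _ _ h, if_pos ⟨rfl, rfl⟩]
      linarith
    · rw [q2Matrix_mulVec_quadratic_center w v _ ha hb (hw' a ha) (hv' b hb) p h1 h2]
      norm_num
    · rw [q2Matrix_mulVec_quadratic_verticalEdge w v _ ha hb (hw' a ha.le) (hv' b hb)
        (hw' (a + 1) ha) p h1 h2]
      norm_num
    · rw [q2Matrix_mulVec_quadratic_horizontalEdge w v _ ha hb (hw' a ha) (hv' b hb.le)
        (hv' (b + 1) hb) p h1 h2]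
      norm_num
    · rw [q2Matrix_mulVec_quadratic_knot w v _ ha hb (hw' a ha.le) (hv' b hb.le)
        (hw' (a + 1) ha) (hv' (b + 1) hb) p h1 h2]
      norm_num
end

section
/- Let m, n ≥ 2 be integers and h > 0. Let A be the real matrix indexed by pairs (i,j) with 1 ≤ i ≤ m, 1 ≤ j ≤ n, defined by: A((i,j),(i,j)) = 20/(6h²); A((i,j),(k,l)) = −4/(6h²) if |i−k| + |j−l| = 1; A((i,j),(k,l)) = −1/(6h²) if |i−k| = 1 and |j−l| = 1; and A((i,j),(k,l)) = 0 otherwise. Then A is a nonsingular M-matrix; in particular A is invertible and A⁻¹ ≥ 0 entrywise. -/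
/-- A Z-matrix that maps some positive vector to a positive vector is monotone. -/
lemma Matrix.nonneg_of_mulVec_nonneg {ι : Type*} [Fintype ι] (A : Matrix ι ι ℝ)
    (hZ : ∀ p q, p ≠ q → A p q ≤ 0) (w : ι → ℝ) (hw : ∀ p, 0 < w p)
    (hAw : ∀ p, 0 < (A.mulVec w) p) (x : ι → ℝ) (hx : ∀ p, 0 ≤ (A.mulVec x) p) (p : ι) :
    0 ≤ x p := by
  obtain ⟨r, -, hr⟩ := Finset.exists_min_image Finset.univ (fun q => x q / w q)
    ⟨p, Finset.mem_univ p⟩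
  by_contra! hp
  have hc : x r / w r < 0 :=
    (hr p (Finset.mem_univ p)).trans_lt (div_neg_of_neg_of_pos hp (hw p))
  set c := x r / w r with hcdef
  have hy : ∀ q, 0 ≤ x q - c * w q := fun q => by
    have := hr q (Finset.mem_univ q)
    rw [le_div_iff₀ (hw q)] at this
    linarith
  have hyr : x r - c * w r = 0 := by
    rw [hcdef, div_mul_cancel₀ _ (hw r).ne', sub_self]
  have h1 : ∑ q, A r q * (x q - c * w q) ≤ 0 := by
    refine Finset.sum_nonpos fun q _ => ?_
    by_cases hq : r = q
    · subst hq
      rw [hyr, mul_zero]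
    · exact mul_nonpos_of_nonpos_of_nonneg (hZ r q hq) (hy q)
  have h2 : ∑ q, A r q * (x q - c * w q) = A.mulVec x r - c * A.mulVec w r := by
    simp only [Matrix.mulVec, dotProduct, Finset.mul_sum, ← Finset.sum_sub_distrib]
    exact Finset.sum_congr rfl fun q _ => by ring
  have h3 := mul_neg_of_neg_of_pos hc (hAw r)
  linarith [hx r]

/-- A Z-matrix that maps some positive vector to a positive vector is a nonsingular M-matrix. -/
lemma Matrix.isUnit_and_inv_nonneg_of_mulVec_pos {ι : Type*} [Fintype ι] [DecidableEq ι]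
    (A : Matrix ι ι ℝ) (hZ : ∀ p q, p ≠ q → A p q ≤ 0) (w : ι → ℝ) (hw : ∀ p, 0 < w p)
    (hAw : ∀ p, 0 < (A.mulVec w) p) :
    IsUnit A ∧ ∀ p q, 0 ≤ A⁻¹ p q := by
  have hmono := A.nonneg_of_mulVec_nonneg hZ w hw hAw
  have hU : IsUnit A := by
    rw [← Matrix.mulVec_injective_iff_isUnit]
    intro x y hxy
    have key : ∀ u v : ι → ℝ, A.mulVec u = A.mulVec v → ∀ p, v p ≤ u p := by
      intro u v huv p
      have := hmono (u - v) (fun p => by rw [Matrix.mulVec_sub, huv, sub_self]; simp) p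
      simpa using this
    exact funext fun p => le_antisymm (key y x hxy.symm p) (key x y hxy p)
  refine ⟨hU, fun p q => ?_⟩
  refine hmono (fun k => A⁻¹ k q) (fun r => ?_) p
  have h1 : A.mulVec (fun k => A⁻¹ k q) r = (A * A⁻¹) r q := rfl
  rw [h1, Matrix.mul_nonsing_inv A ((Matrix.isUnit_iff_isUnit_det A).mp hU), Matrix.one_apply]
  split_ifs <;> norm_num

/-- The tridiagonal stencil `1, 4, 1`. -/
def tridiagStencil (i k : ℤ) : ℝ :=
  (if k = i - 1 then 1 else 0) + (if k = i then 4 else 0) + (if k = i + 1 then 1 else 0)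

lemma sum_fin_ite_eq_le (m : ℕ) (c : ℤ) (a : ℝ) (ha : 0 ≤ a) :
    ∑ k : Fin m, (if (k : ℤ) = c then a else 0) ≤ a := by
  by_cases hc : ∃ k : Fin m, (k : ℤ) = c
  · obtain ⟨k, rfl⟩ := hc
    have : ∀ l : Fin m, ((l : ℤ) = (k : ℤ)) ↔ l = k := fun l => by
      rw [Fin.ext_iff]; exact Nat.cast_inj
    simp [this]
  · push Not at hc
    simpa [hc] using ha

lemma sum_tridiagStencil_mul_le (m : ℕ) (i : ℤ) (f : ℤ → ℝ) (h₁ : 0 ≤ f (i - 1))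
    (h₂ : 0 ≤ f i) (h₃ : 0 ≤ f (i + 1)) :
    ∑ k : Fin m, tridiagStencil i k * f k ≤ f (i - 1) + 4 * f i + f (i + 1) := by
  have hs : ∀ k : Fin m, tridiagStencil i k * f k =
      (if (k : ℤ) = i - 1 then f (i - 1) else 0) + (if (k : ℤ) = i then 4 * f i else 0) +
        (if (k : ℤ) = i + 1 then f (i + 1) else 0) := by
    intro k
    unfold tridiagStencil
    rw [add_mul, add_mul]
    congr 1
    · congr 1
      · split_ifs with hk <;> simp [hk]
      · split_ifs with hk <;> simp [hk]
    · split_ifs with hk <;> simp [hk]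
  simp only [hs, Finset.sum_add_distrib]
  exact add_le_add (add_le_add (sum_fin_ite_eq_le m _ _ h₁)
    (sum_fin_ite_eq_le m _ _ (by linarith))) (sum_fin_ite_eq_le m _ _ h₃)

/-- The 9-point stencil is `36` times the identity minus the tensor square of `1, 4, 1`. -/
lemma nine_point_stencil_eq (a b c d : ℤ) :
    (if a = c ∧ b = d then (20 : ℝ)
      else if |a - c| + |b - d| = 1 then -4
      else if |a - c| = 1 ∧ |b - d| = 1 then -1 else 0) =
    (if a = c ∧ b = d then 36 else 0) - tridiagStencil a c * tridiagStencil b d := by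
  have key : ∀ x y : ℤ, (y = x ∧ |x - y| = 0 ∧ tridiagStencil x y = 4) ∨
      (x ≠ y ∧ |x - y| = 1 ∧ tridiagStencil x y = 1) ∨
      (x ≠ y ∧ 2 ≤ |x - y| ∧ tridiagStencil x y = 0) := by
    intro x y
    unfold tridiagStencil
    rcases lt_trichotomy x y with hxy | hxy | hxy
    · rw [abs_of_neg (by omega)]
      right
      by_cases h1 : y = x + 1
      · left
        refine ⟨hxy.ne, by omega, ?_⟩
        rw [if_neg (by omega), if_neg (by omega), if_pos h1]
        norm_num
      · right
        refine ⟨hxy.ne, by omega, ?_⟩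
        rw [if_neg (by omega), if_neg (by omega), if_neg h1]
        norm_num
    · subst hxy
      left
      refine ⟨rfl, by simp, ?_⟩
      rw [if_neg (by omega), if_pos rfl, if_neg (by omega)]
      norm_num
    · rw [abs_of_pos (by omega)]
      right
      by_cases h1 : y = x - 1
      · left
        refine ⟨hxy.ne', by omega, ?_⟩
        rw [if_pos h1, if_neg (by omega), if_neg (by omega)]
        norm_num
      · right
        refine ⟨hxy.ne', by omega, ?_⟩
        rw [if_neg h1, if_neg (by omega), if_neg (by omega)]
        norm_num
  have hac := abs_nonneg (a - c)
  have hbd := abs_nonneg (b - d)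
  rcases key a c with ⟨h1, h2, h3⟩ | ⟨h1, h2, h3⟩ | ⟨h1, h2, h3⟩ <;>
  rcases key b d with ⟨h4, h5, h6⟩ | ⟨h4, h5, h6⟩ | ⟨h4, h5, h6⟩ <;>
  rw [h3, h6] <;> split_ifs <;> first | omega | norm_num


/-- the stiffness matrix of the classical fourth order 9-point scheme on
a uniform grid with `Δx = Δy = h` is a nonsingular M-matrix; in particular it is
invertible with entrywise nonnegative inverse. -/
theorem stmt14 (m n : ℕ) (hm : 2 ≤ m) (hn : 2 ≤ n) (h : ℝ) (hh : 0 < h)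
    (A : Matrix (Fin m × Fin n) (Fin m × Fin n) ℝ)
    (hA : ∀ p q : Fin m × Fin n,
      A p q =
        if p = q then 20 / (6 * h ^ 2)
        else if |(p.1 : ℤ) - (q.1 : ℤ)| + |(p.2 : ℤ) - (q.2 : ℤ)| = 1 then
          -(4 / (6 * h ^ 2))
        else if |(p.1 : ℤ) - (q.1 : ℤ)| = 1 ∧ |(p.2 : ℤ) - (q.2 : ℤ)| = 1 then
          -(1 / (6 * h ^ 2))
        else 0) :
    (∀ p q, p ≠ q → A p q ≤ 0) ∧ IsUnit A ∧ ∀ p q, 0 ≤ A⁻¹ p q := by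
  have hs : (0 : ℝ) < 6 * h ^ 2 := by positivity
  have hA' : ∀ p q, A p q = ((if p = q then 36 else 0) -
      tridiagStencil p.1 q.1 * tridiagStencil p.2 q.2) / (6 * h ^ 2) := by
    intro p q
    have hpq : p = q ↔ ((p.1 : ℕ) : ℤ) = (q.1 : ℕ) ∧ ((p.2 : ℕ) : ℤ) = (q.2 : ℕ) := by
      rw [Prod.ext_iff, Fin.ext_iff, Fin.ext_iff, Nat.cast_inj, Nat.cast_inj]
    rw [hA]
    simp only [hpq]
    rw [← nine_point_stencil_eq]
    split_ifs <;> ring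
  have hZ : ∀ p q, p ≠ q → A p q ≤ 0 := by
    intro p q hpq
    rw [hA, if_neg hpq]
    split_ifs
    · exact neg_nonpos.mpr (by positivity)
    · exact neg_nonpos.mpr (by positivity)
    · exact le_rfl
  let f : ℤ → ℝ := fun k => ((k : ℝ) + 1) * (m - k)
  have hf : ∀ i : Fin m, 0 < f i := fun i => by
    have h1 : ((i : ℕ) : ℝ) < m := by exact_mod_cast i.2
    simp only [f, Int.cast_natCast]
    exact mul_pos (by positivity) (by linarith)
  refine ⟨hZ, A.isUnit_and_inv_nonneg_of_mulVec_pos hZ (fun p => f p.1) (fun p => hf p.1) ?_⟩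
  intro p
  have hsum : A.mulVec (fun q => f q.1) p =
      (36 * f p.1 - (∑ k : Fin m, tridiagStencil p.1 k * f k) *
        ∑ l : Fin n, tridiagStencil p.2 l * 1) / (6 * h ^ 2) := by
    have h36 : 36 * f p.1 = ∑ q : Fin m × Fin n, (if p = q then 36 else 0) * f q.1 := by
      simp
    rw [h36, Finset.sum_mul_sum, ← Fintype.sum_prod_type', ← Finset.sum_sub_distrib,
      Finset.sum_div]
    refine Finset.sum_congr rfl fun q _ => ?_
    beta_reduce
    rw [hA']
    ring
  have hi : ((p.1 : ℕ) : ℝ) + 1 ≤ m := by exact_mod_cast p.1.2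
  have hi0 : (0 : ℝ) ≤ ((p.1 : ℕ) : ℝ) := Nat.cast_nonneg _
  have hrow := sum_tridiagStencil_mul_le m p.1 f
    (by simp only [f]; push_cast; exact mul_nonneg (by linarith) (by linarith)) (hf p.1).le
    (by simp only [f]; push_cast; exact mul_nonneg (by linarith) (by linarith))
  have hconcave : f ((p.1 : ℕ) - 1) + 4 * f (p.1 : ℕ) + f ((p.1 : ℕ) + 1) =
      6 * f (p.1 : ℕ) - 2 := by
    simp only [f]
    push_cast
    ring
  have hcol := sum_tridiagStencil_mul_le n p.2 (fun _ => 1) (by norm_num) (by norm_num)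
    (by norm_num)
  have hnonneg : ∀ i k, 0 ≤ tridiagStencil i k := fun i k => by
    unfold tridiagStencil
    positivity
  have hrow0 : 0 ≤ ∑ k : Fin m, tridiagStencil p.1 k * f k :=
    Finset.sum_nonneg fun k _ => mul_nonneg (hnonneg _ _) (hf k).le
  rw [hsum]
  refine div_pos ?_ hs
  have := mul_le_mul_of_nonneg_left hcol hrow0
  linarith
end

section
/- Let Δx, Δy > 0. The three off-diagonal stencil coefficients of the fourth order 9-point scheme for −Δu = f on an anisotropic uniform grid — namely c₁ = −10/(12Δx²) + 2/(12Δy²) (horizontal neighbors), c₂ = 2/(12Δx²) − 10/(12Δy²) (vertical neighbors), and c₃ = −1/(12Δx²) − 1/(12Δy²) (diagonal neighbors) — are all nonpositive if and only if 1/√5 ≤ Δx/Δy ≤ √5. -/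
/-- For positive reals, `x / y ≤ √c` is the quadratic inequality `x ^ 2 ≤ c * y ^ 2`. -/
theorem div_le_sqrt_iff_sq_le_mul_sq {x y : ℝ} (c : ℝ) (hx : 0 < x) (hy : 0 < y) :
    x / y ≤ Real.sqrt c ↔ x ^ 2 ≤ c * y ^ 2 := by
  rw [Real.le_sqrt' (div_pos hx hy), div_pow, div_le_iff₀ (pow_pos hy 2)]

/-- An edge coefficient of the 9-point stencil is nonpositive iff `x ^ 2 ≤ 5 * y ^ 2`. -/
theorem two_div_le_ten_div_iff {x y : ℝ} (hx : 0 < x) (hy : 0 < y) :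
    2 / (12 * y ^ 2) ≤ 10 / (12 * x ^ 2) ↔ x ^ 2 ≤ 5 * y ^ 2 := by
  rw [div_le_div_iff₀ (by positivity) (by positivity)]
  constructor <;> intro h <;> linarith

/-- the three off-diagonal stencil coefficients of the anisotropic
9-point scheme are all nonpositive iff `1/√5 ≤ Δx/Δy ≤ √5`. -/
theorem stmt15 (Δx Δy : ℝ) (hΔx : 0 < Δx) (hΔy : 0 < Δy) :
    (-(10 / (12 * Δx ^ 2)) + 2 / (12 * Δy ^ 2) ≤ 0 ∧
     2 / (12 * Δx ^ 2) - 10 / (12 * Δy ^ 2) ≤ 0 ∧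
     -(1 / (12 * Δx ^ 2)) - 1 / (12 * Δy ^ 2) ≤ 0) ↔
    (1 / Real.sqrt 5 ≤ Δx / Δy ∧ Δx / Δy ≤ Real.sqrt 5) := by
  have hdiag : -(1 / (12 * Δx ^ 2)) - 1 / (12 * Δy ^ 2) ≤ 0 := by
    have hx : 0 < 1 / (12 * Δx ^ 2) := by positivity
    have hy : 0 < 1 / (12 * Δy ^ 2) := by positivity
    linarith
  have hinv : 1 / Real.sqrt 5 ≤ Δx / Δy ↔ Δy / Δx ≤ Real.sqrt 5 := by
    rw [one_div_le (by positivity) (by positivity), one_div_div]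
  rw [hinv, div_le_sqrt_iff_sq_le_mul_sq 5 hΔy hΔx, div_le_sqrt_iff_sq_le_mul_sq 5 hΔx hΔy,
    ← two_div_le_ten_div_iff hΔy hΔx, ← two_div_le_ten_div_iff hΔx hΔy, sub_nonpos,
    neg_add_nonpos_iff, and_iff_left hdiag, and_comm]
end

section
/- Let N ≥ 1 and N∂ ≥ 1, let L be a real N×N matrix and B a real N×N∂ matrix, and let T be the (N+N∂)×(N+N∂) block matrix T = [[L, B],[0, I]], where I is the N∂×N∂ identity. Assume T is invertible with T⁻¹ ≥ 0 entrywise and every row sum of T is nonnegative. Then for every u ∈ ℝᴺ and u∂ ∈ ℝ^{N∂} with (Lu + Bu∂)_i = 0 for every i ∈ {1,…,N}, one has |u_i| ≤ max_{1≤j≤N∂} |u∂_j| for all i ∈ {1,…,N}. -/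
/-- A vector with nonnegative image under an inverse-positive matrix is nonnegative. -/
theorem nonneg_of_mulVec_nonneg {n : Type*} [Fintype n] [DecidableEq n] {A : Matrix n n ℝ}
    (hA : IsUnit A) (hinv : ∀ i j, 0 ≤ A⁻¹ i j) {v : n → ℝ} (hv : ∀ i, 0 ≤ A.mulVec v i) (i : n) :
    0 ≤ v i := by
  have h : A⁻¹.mulVec (A.mulVec v) = v := by
    rw [Matrix.mulVec_mulVec, Matrix.nonsing_inv_mul A ((Matrix.isUnit_iff_isUnit_det A).mp hA),
      Matrix.one_mulVec]
  rw [← h]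
  exact Finset.sum_nonneg fun j _ => mul_nonneg (hinv i j) (hv j)

/-- One-sided discrete maximum principle: a discrete harmonic function is at least `-M` when its
boundary values are, for `M ≥ 0`. -/
theorem neg_le_of_blockT_inverse_nonneg {N Nb : ℕ}
    {L : Matrix (Fin N) (Fin N) ℝ} {B : Matrix (Fin N) (Fin Nb) ℝ}
    (hT : IsUnit (blockT L B)) (hTinv : ∀ i j, 0 ≤ (blockT L B)⁻¹ i j)
    (hrow : ∀ i, 0 ≤ ∑ j, blockT L B i j) {u : Fin N → ℝ} {ub : Fin Nb → ℝ}
    (hscheme : L.mulVec u + B.mulVec ub = 0) {M : ℝ} (hM : 0 ≤ M) (hub : ∀ j, -M ≤ ub j)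
    (i : Fin N) : -M ≤ u i := by
  have himage : (blockT L B).mulVec (Sum.elim u ub) = Sum.elim (0 : Fin N → ℝ) ub := by
    simp [blockT, Matrix.fromBlocks_mulVec, hscheme]
  have hconst (k) : (blockT L B).mulVec (fun _ => M) k = (∑ j, blockT L B k j) * M := by
    simp only [Matrix.mulVec, dotProduct, Finset.sum_mul]
  have h := nonneg_of_mulVec_nonneg hT hTinv (v := (fun _ => M) + Sum.elim u ub) (fun k => by
    rw [Matrix.mulVec_add, Pi.add_apply, himage, hconst]
    rcases k with k | k
    · simpa using mul_nonneg (hrow (Sum.inl k)) hM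
    · have hsum : ∑ j, blockT L B (Sum.inr k) j = 1 := by
        simp [blockT, Matrix.one_apply]
      rw [hsum, Sum.elim_inr]
      linarith [hub k]) (Sum.inl i)
  simp only [Pi.add_apply, Sum.elim_inl] at h
  linarith

/-- if the block matrix `T = [[L, B], [0, I]]` is inverse positive with
nonnegative row sums, then a discrete harmonic function is bounded by its boundary
values: `Lu + Bu∂ = 0` implies `|uᵢ| ≤ max_j |u∂ⱼ|`. -/
theorem stmt17 {N Nb : ℕ} (hN : 1 ≤ N) (hNb : 1 ≤ Nb)
    (L : Matrix (Fin N) (Fin N) ℝ) (B : Matrix (Fin N) (Fin Nb) ℝ)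
    (hT : IsUnit (blockT L B))
    (hTinv : ∀ i j, 0 ≤ (blockT L B)⁻¹ i j)
    (hrow : ∀ i, 0 ≤ ∑ j, blockT L B i j)
    (u : Fin N → ℝ) (ub : Fin Nb → ℝ)
    (hscheme : ∀ i, (L.mulVec u + B.mulVec ub) i = 0) :
    ∀ i, |u i| ≤ ⨆ j, |ub j| := by
  have hub (j) : |ub j| ≤ ⨆ j, |ub j| := le_ciSup (Set.finite_range fun j => |ub j|).bddAbove j
  have hM : 0 ≤ ⨆ j, |ub j| := Real.iSup_nonneg fun j => abs_nonneg (ub j)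
  have hharm : L.mulVec u + B.mulVec ub = 0 := funext hscheme
  have hharm_neg : L.mulVec (-u) + B.mulVec (-ub) = 0 := by
    rw [Matrix.mulVec_neg, Matrix.mulVec_neg, ← neg_add, hharm, neg_zero]
  intro i
  refine abs_le.mpr ⟨?_, ?_⟩
  · exact neg_le_of_blockT_inverse_nonneg hT hTinv hrow hharm hM
      (fun j => (abs_le.mp (hub j)).1) i
  · exact neg_le_neg_iff.mp (neg_le_of_blockT_inverse_nonneg hT hTinv hrow hharm_neg hM
      (fun j => neg_le_neg (abs_le.mp (hub j)).2) i)
end
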